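/- Let n ≥ 2 be an integer. There exists a constant C > 0 (depending only on n) such that: if u₀, u₁ are compactly supported smooth functions on ℝⁿ and u : [0,∞) × ℝⁿ → ℝ is a smooth function satisfying ∂_t² u = Δu on (0,∞) × ℝⁿ with u(0,·) = u₀ and ∂_t u(0,·) = u₁, then for all t ≥ 0, ‖u(t,·)‖_{L^∞(ℝⁿ)} ≤ C (Σ_{|α| ≤ n} ‖∂^α u₀‖_{L¹(ℝⁿ)} + Σ_{|α| ≤ n−1} ‖∂^α u₁‖_{L¹(ℝⁿ)}) (1+t)^{−(n−1)/2}. -/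

import Mathlib

open MeasureTheory ENNReal

noncomputable section

/-- The time derivative `∂ₜ` on `ℝ × ℝⁿ`. -/
def wdt (n : ℕ) (u : ℝ × EuclideanSpace ℝ (Fin n) → ℝ) : ℝ × EuclideanSpace ℝ (Fin n) → ℝ :=
  fun p => fderiv ℝ u p ((1:ℝ), 0)

/-- The spatial derivative `∂ᵢ` on `ℝ × ℝⁿ`. -/
def wdi (n : ℕ) (i : Fin n) (u : ℝ × EuclideanSpace ℝ (Fin n) → ℝ) :
    ℝ × EuclideanSpace ℝ (Fin n) → ℝ :=
  fun p => fderiv ℝ u p ((0:ℝ), EuclideanSpace.single i 1)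

/-- The rotation `Ω_{ij} = xᵢ∂ⱼ − xⱼ∂ᵢ`. -/
def wOm (n : ℕ) (i j : Fin n) (u : ℝ × EuclideanSpace ℝ (Fin n) → ℝ) :
    ℝ × EuclideanSpace ℝ (Fin n) → ℝ :=
  fun p => p.2 i * wdi n j u p - p.2 j * wdi n i u p

/-- The scaling field `L₀ = t∂ₜ + Σᵢ xᵢ∂ᵢ`. -/
def wL0 (n : ℕ) (u : ℝ × EuclideanSpace ℝ (Fin n) → ℝ) : ℝ × EuclideanSpace ℝ (Fin n) → ℝ :=
  fun p => p.1 * wdt n u p + ∑ i, p.2 i * wdi n i u p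

/-- The Lorentz boost `Lᵢ = t∂ᵢ + xᵢ∂ₜ`. -/
def wLi (n : ℕ) (i : Fin n) (u : ℝ × EuclideanSpace ℝ (Fin n) → ℝ) :
    ℝ × EuclideanSpace ℝ (Fin n) → ℝ :=
  fun p => p.1 * wdi n i u p + p.2 i * wdt n u p



/-- Continuous weights vanishing outside the unit ball. -/
def IsWt {n : ℕ} (μ : EuclideanSpace ℝ (Fin n) → ℝ) : Prop :=
  Continuous μ ∧ ∀ w, 1 ≤ ‖w‖ → μ w = 0

lemma IsWt.hasCompactSupport {n : ℕ} {μ : EuclideanSpace ℝ (Fin n) → ℝ} (h : IsWt μ) :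
    HasCompactSupport μ := by
  apply HasCompactSupport.intro (isCompact_closedBall (0 : EuclideanSpace ℝ (Fin n)) 1)
  intro x hx
  apply h.2
  simp at hx
  exact hx.le

lemma IsWt.integrable_smul {n : ℕ} {μ : EuclideanSpace ℝ (Fin n) → ℝ} (h : IsWt μ)
    {X : Type*} [NormedAddCommGroup X] [NormedSpace ℝ X] {f : EuclideanSpace ℝ (Fin n) → X}
    (hf : Continuous f) : Integrable (fun w => μ w • f w) :=
  (h.1.smul hf).integrable_of_hasCompactSupport h.hasCompactSupport.smul_right

lemma IsWt.integrable_mul {n : ℕ} {μ : EuclideanSpace ℝ (Fin n) → ℝ} (h : IsWt μ)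
    {f : EuclideanSpace ℝ (Fin n) → ℝ}
    (hf : Continuous f) : Integrable (fun w => f w * μ w) :=
  (hf.mul h.1).integrable_of_hasCompactSupport h.hasCompactSupport.mul_left

lemma param_hasFDerivAt {n : ℕ} {μ : EuclideanSpace ℝ (Fin n) → ℝ} (h : IsWt μ)
    {P X : Type} [NormedAddCommGroup P] [NormedSpace ℝ P] [FiniteDimensional ℝ P]
    [NormedAddCommGroup X] [NormedSpace ℝ X]
    {F : P × EuclideanSpace ℝ (Fin n) → X} (hF : ContDiff ℝ 1 F) (p : P) :
    HasFDerivAt (fun p => ∫ w, μ w • F (p, w))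
      (∫ w, μ w • (fderiv ℝ F (p, w)).comp (ContinuousLinearMap.inl ℝ P _)) p := by
  have : ProperSpace P := FiniteDimensional.proper ℝ P
  have hF' : Continuous (fun q => (fderiv ℝ F q).comp
      (ContinuousLinearMap.inl ℝ P (EuclideanSpace ℝ (Fin n)))) := by
    have := hF.continuous_fderiv one_ne_zero
    fun_prop
  obtain ⟨M, hM⟩ := ((isCompact_closedBall p 1).prod
    (isCompact_closedBall (0 : EuclideanSpace ℝ (Fin n)) 1)).bddAbove_image
      hF'.norm.continuousOn
  have hFc := hF.continuous
  apply hasFDerivAt_integral_of_dominated_of_fderiv_le (s := Metric.closedBall p 1)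
    (F' := fun p w => μ w • (fderiv ℝ F (p, w)).comp (ContinuousLinearMap.inl ℝ P _))
    (bound := fun w => M * ‖μ w‖)
    (Metric.closedBall_mem_nhds p one_pos)
  · filter_upwards with x
    exact (h.integrable_smul (by fun_prop)).aestronglyMeasurable
  · exact h.integrable_smul (by fun_prop)
  · exact (h.integrable_smul (f := fun w => (fderiv ℝ F (p, w)).comp
      (ContinuousLinearMap.inl ℝ P _)) (hF'.comp (by fun_prop))).aestronglyMeasurable
  · filter_upwards with w x hx
    by_cases hw : 1 ≤ ‖w‖
    · simp [h.2 w hw]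
    · rw [norm_smul, mul_comm]
      gcongr
      apply hM
      refine ⟨(x, w), ⟨hx, ?_⟩, rfl⟩
      simp; linarith
  · apply Integrable.const_mul
    exact (h.1.integrable_of_hasCompactSupport h.hasCompactSupport).norm
  · filter_upwards with w x hx
    apply HasFDerivAt.const_smul
    have h1 : HasFDerivAt F (fderiv ℝ F (x, w)) (x, w) :=
      (hF.differentiable one_ne_zero _).hasFDerivAt
    exact h1.comp x (hasFDerivAt_prodMk_left x w)

lemma param_contDiff_nat {n : ℕ} {μ : EuclideanSpace ℝ (Fin n) → ℝ} (h : IsWt μ)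
    {P : Type} [NormedAddCommGroup P] [NormedSpace ℝ P] [FiniteDimensional ℝ P] (k : ℕ) :
    ∀ {X : Type} [NormedAddCommGroup X] [NormedSpace ℝ X]
    {F : P × EuclideanSpace ℝ (Fin n) → X} (_ : ContDiff ℝ (⊤ : ℕ∞) F),
    ContDiff ℝ k (fun p => ∫ w, μ w • F (p, w)) := by
  induction k with
  | zero =>
    intro X _ _ F hF
    have h1 : ContDiff ℝ 1 F := hF.of_le (by simp)
    simp only [Nat.cast_zero, contDiff_zero]
    rw [continuous_iff_continuousAt]
    intro p
    exact (param_hasFDerivAt h h1 p).continuousAt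
  | succ k ih =>
    intro X _ _ F hF
    have h1 : ContDiff ℝ 1 F := hF.of_le (by simp)
    have h2 : ContDiff ℝ (⊤ : ℕ∞) (fun q => (fderiv ℝ F q).comp
      (ContinuousLinearMap.inl ℝ P (EuclideanSpace ℝ (Fin n)))) := by
      have := hF.fderiv_right (m := (⊤ : ℕ∞)) (by simp)
      fun_prop
    rw [Nat.cast_add, Nat.cast_one, contDiff_succ_iff_fderiv]
    refine ⟨fun p => (param_hasFDerivAt h h1 p).differentiableAt, by simp, ?_⟩
    have : fderiv ℝ (fun p => ∫ w, μ w • F (p, w)) = fun p =>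
        ∫ w, μ w • (fderiv ℝ F (p, w)).comp (ContinuousLinearMap.inl ℝ P _) := by
      ext1 p
      exact (param_hasFDerivAt h h1 p).fderiv
    rw [this]
    exact ih h2

lemma param_contDiff {n : ℕ} {μ : EuclideanSpace ℝ (Fin n) → ℝ} (h : IsWt μ)
    {P : Type} [NormedAddCommGroup P] [NormedSpace ℝ P] [FiniteDimensional ℝ P]
    {F : P × EuclideanSpace ℝ (Fin n) → ℝ} (hF : ContDiff ℝ (⊤ : ℕ∞) F) :
    ContDiff ℝ (⊤ : ℕ∞) (fun p => ∫ w, F (p, w) * μ w) := by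
  rw [contDiff_infty]
  intro k
  have := param_contDiff_nat h k hF
  simpa only [smul_eq_mul, mul_comm] using this

lemma param_fderiv {n : ℕ} {μ : EuclideanSpace ℝ (Fin n) → ℝ} (h : IsWt μ)
    {P : Type} [NormedAddCommGroup P] [NormedSpace ℝ P] [FiniteDimensional ℝ P]
    {F : P × EuclideanSpace ℝ (Fin n) → ℝ} (hF : ContDiff ℝ (⊤ : ℕ∞) F) (p v : P) :
    fderiv ℝ (fun p => ∫ w, F (p, w) * μ w) p v = ∫ w, fderiv ℝ F (p, w) (v, 0) * μ w := by
  have h1 : ContDiff ℝ 1 F := hF.of_le (by simp)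
  have h2 := (param_hasFDerivAt h h1 p).fderiv
  simp only [smul_eq_mul, mul_comm (μ _)] at h2
  rw [h2, ContinuousLinearMap.integral_apply]
  · simp [mul_comm]
  · apply h.integrable_smul (f := fun w => (fderiv ℝ F (p, w)).comp
      (ContinuousLinearMap.inl ℝ P _))
    have := h1.continuous_fderiv one_ne_zero
    fun_prop

/-- Core integration by parts against a `C¹` compactly supported weight. -/
lemma ibp_core {n : ℕ} {f η : EuclideanSpace ℝ (Fin n) → ℝ} (hf : ContDiff ℝ 1 f)
    (hη : ContDiff ℝ 1 η) (hc : HasCompactSupport η) (v : EuclideanSpace ℝ (Fin n)) :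
    ∫ w, fderiv ℝ f w v * η w = - ∫ w, f w * fderiv ℝ η w v := by
  have c1 := hf.continuous_fderiv one_ne_zero
  have c2 := hη.continuous_fderiv one_ne_zero
  have c3 := hf.continuous
  have c4 := hη.continuous
  have hc' : HasCompactSupport (fun w => fderiv ℝ η w v) := hc.fderiv_apply ℝ v
  rw [integral_mul_fderiv_eq_neg_fderiv_mul_of_integrable, neg_neg]
  · exact Continuous.integrable_of_hasCompactSupport (by fun_prop) hc.mul_left
  · exact Continuous.integrable_of_hasCompactSupport (by fun_prop) hc'.mul_left
  · exact Continuous.integrable_of_hasCompactSupport (by fun_prop) hc.mul_left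
  · exact fun x _ => hf.differentiable one_ne_zero x
  · exact fun x _ => hη.differentiable one_ne_zero x



/-- `C¹` radial profile (in the variable `q = |w|²`) vanishing for `q ≥ 1`. -/
structure IsProf (θ θ' : ℝ → ℝ) : Prop where
  hd : ∀ q, HasDerivAt θ (θ' q) q
  hc : Continuous θ'
  h0 : ∀ q, 1 ≤ q → θ q = 0
  h0' : ∀ q, 1 ≤ q → θ' q = 0

lemma IsProf.cont {θ θ' : ℝ → ℝ} (h : IsProf θ θ') : Continuous θ :=
  continuous_iff_continuousAt.2 fun q => (h.hd q).continuousAt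

lemma rad_isWt {n : ℕ} {θ : ℝ → ℝ} (hc : Continuous θ) (h0 : ∀ q, 1 ≤ q → θ q = 0) :
    IsWt (fun w : EuclideanSpace ℝ (Fin n) => θ (‖w‖ ^ 2)) := by
  refine ⟨by fun_prop, fun w hw => h0 _ ?_⟩
  nlinarith

lemma IsProf.wt {n : ℕ} {θ θ' : ℝ → ℝ} (h : IsProf θ θ') :
    IsWt (fun w : EuclideanSpace ℝ (Fin n) => θ (‖w‖ ^ 2)) := rad_isWt h.cont h.h0

lemma IsProf.hasFDerivAt {n : ℕ} {θ θ' : ℝ → ℝ} (h : IsProf θ θ')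
    (w : EuclideanSpace ℝ (Fin n)) :
    HasFDerivAt (fun w : EuclideanSpace ℝ (Fin n) => θ (‖w‖ ^ 2))
      (θ' (‖w‖ ^ 2) • (2 • (innerSL ℝ w))) w := by
  have h1 : HasFDerivAt (fun w : EuclideanSpace ℝ (Fin n) => ‖w‖ ^ 2) (2 • (innerSL ℝ w)) w :=
    (hasStrictFDerivAt_norm_sq w).hasFDerivAt
  exact (h.hd (‖w‖ ^ 2)).comp_hasFDerivAt w h1

lemma IsProf.contDiff {n : ℕ} {θ θ' : ℝ → ℝ} (h : IsProf θ θ') :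
    ContDiff ℝ 1 (fun w : EuclideanSpace ℝ (Fin n) => θ (‖w‖ ^ 2)) := by
  have h1 : ContDiff ℝ 1 θ := by
    rw [contDiff_one_iff_deriv]
    refine ⟨fun q => (h.hd q).differentiableAt, ?_⟩
    have : deriv θ = θ' := funext fun q => (h.hd q).deriv
    rw [this]; exact h.hc
  exact h1.comp (contDiff_norm_sq ℝ)

lemma ibp1 {n : ℕ} {θ θ' : ℝ → ℝ} (h : IsProf θ θ') {f : EuclideanSpace ℝ (Fin n) → ℝ}
    (hf : ContDiff ℝ 1 f) (i : Fin n) :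
    ∫ w, fderiv ℝ f w (EuclideanSpace.single i 1) * θ (‖w‖ ^ 2) =
      - ∫ w, f w * (2 * w i * θ' (‖w‖ ^ 2)) := by
  rw [ibp_core hf h.contDiff h.wt.hasCompactSupport]
  congr 1
  apply integral_congr_ae
  filter_upwards with w
  rw [(h.hasFDerivAt w).fderiv]
  simp [EuclideanSpace.inner_single_right]
  left; ring

lemma ibp2 {n : ℕ} {θ θ' : ℝ → ℝ} (h : IsProf θ θ') {f : EuclideanSpace ℝ (Fin n) → ℝ}
    (hf : ContDiff ℝ 1 f) :
    ∫ w, fderiv ℝ f w w * θ (‖w‖ ^ 2) =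
      - ∫ w, f w * (n * θ (‖w‖ ^ 2) + 2 * ‖w‖ ^ 2 * θ' (‖w‖ ^ 2)) := by
  have c1 := hf.continuous_fderiv one_ne_zero
  have c3 := hf.continuous
  have hco : ∀ i : Fin n, ContDiff ℝ 1 (fun w : EuclideanSpace ℝ (Fin n) => w i) := fun i =>
    (EuclideanSpace.proj (𝕜 := ℝ) i).contDiff
  have key : ∀ i : Fin n, ∫ w, fderiv ℝ f w (EuclideanSpace.single i 1) * (w i * θ (‖w‖ ^ 2)) =
      - ∫ w, f w * (θ (‖w‖ ^ 2) + 2 * (w i) ^ 2 * θ' (‖w‖ ^ 2)) := by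
    intro i
    rw [ibp_core hf (η := fun w => w i * θ (‖w‖ ^ 2)) ((hco i).mul h.contDiff)
      h.wt.hasCompactSupport.mul_left]
    congr 1
    apply integral_congr_ae
    filter_upwards with w
    have h1 : HasFDerivAt (fun w : EuclideanSpace ℝ (Fin n) => w i)
      (EuclideanSpace.proj (𝕜 := ℝ) i : EuclideanSpace ℝ (Fin n) →L[ℝ] ℝ) w :=
      (EuclideanSpace.proj (𝕜 := ℝ) i).hasFDerivAt
    rw [(h1.fun_mul (h.hasFDerivAt w)).fderiv]
    simp [EuclideanSpace.inner_single_right]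
    left; ring
  have e1 : ∀ w : EuclideanSpace ℝ (Fin n), fderiv ℝ f w w * θ (‖w‖ ^ 2) =
      ∑ i, fderiv ℝ f w (EuclideanSpace.single i 1) * (w i * θ (‖w‖ ^ 2)) := by
    intro w
    have hw : w = ∑ i, w i • EuclideanSpace.single i (1:ℝ) := by
      have := (EuclideanSpace.basisFun (Fin n) ℝ).sum_repr w
      simpa using this.symm
    conv_lhs => rw [show fderiv ℝ f w w = fderiv ℝ f w (∑ i, w i • EuclideanSpace.single i (1:ℝ))
      from by rw [← hw]]
    rw [map_sum, Finset.sum_mul]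
    apply Finset.sum_congr rfl
    intro i _
    simp; ring
  have e2 : ∀ w : EuclideanSpace ℝ (Fin n),
      f w * (n * θ (‖w‖ ^ 2) + 2 * ‖w‖ ^ 2 * θ' (‖w‖ ^ 2)) =
      ∑ i, f w * (θ (‖w‖ ^ 2) + 2 * (w i) ^ 2 * θ' (‖w‖ ^ 2)) := by
    intro w
    rw [← Finset.mul_sum, Finset.sum_add_distrib, ← Finset.sum_mul, ← Finset.mul_sum]
    have : ∑ i, (w i) ^ 2 = ‖w‖ ^ 2 := by
      rw [EuclideanSpace.norm_sq_eq]; simp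
    rw [this]; simp
  simp_rw [e1, e2]
  have wt' : IsWt (fun w : EuclideanSpace ℝ (Fin n) => θ' (‖w‖ ^ 2)) := rad_isWt h.hc h.h0'
  rw [integral_finsetSum, integral_finsetSum, Finset.sum_congr rfl (fun i _ => key i),
    Finset.sum_neg_distrib]
  · intro i _
    have a1 := h.wt.integrable_mul (f := f) c3
    have a2 := wt'.integrable_mul (f := fun w => f w * (2 * (w i) ^ 2)) (by fun_prop)
    refine (a1.add a2).congr ?_
    filter_upwards with w
    simp; ring
  · intro i _
    have a1 := h.wt.integrable_mul (f := fun w => fderiv ℝ f w (EuclideanSpace.single i 1) * w i)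
      (by fun_prop)
    refine a1.congr ?_
    filter_upwards with w
    ring

/-- Weighted ball mean at the origin. -/
def Jm {n : ℕ} (g μ : EuclideanSpace ℝ (Fin n) → ℝ) (r : ℝ) : ℝ := ∫ w, g (r • w) * μ w

lemma Jm_contDiff {n : ℕ} {g μ : EuclideanSpace ℝ (Fin n) → ℝ} (hg : ContDiff ℝ (⊤ : ℕ∞) g)
    (h : IsWt μ) : ContDiff ℝ (⊤ : ℕ∞) (Jm g μ) :=
  param_contDiff h (F := fun q : ℝ × EuclideanSpace ℝ (Fin n) => g (q.1 • q.2)) (by fun_prop)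

lemma Jm_deriv {n : ℕ} {g μ : EuclideanSpace ℝ (Fin n) → ℝ} (hg : ContDiff ℝ (⊤ : ℕ∞) g)
    (h : IsWt μ) (r : ℝ) : deriv (Jm g μ) r = ∫ w, fderiv ℝ g (r • w) w * μ w := by
  have := param_fderiv h (F := fun q : ℝ × EuclideanSpace ℝ (Fin n) => g (q.1 • q.2))
    (by fun_prop) r 1
  rw [← fderiv_apply_one_eq_deriv]
  refine this.trans ?_
  congr 1; ext w; congr 1
  have hg1 : HasFDerivAt g (fderiv ℝ g (r • w)) (r • w) :=
    (hg.differentiable (by simp) _).hasFDerivAt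
  have h2 := hg1.comp (r, w) (f := fun q : ℝ × EuclideanSpace ℝ (Fin n) => q.1 • q.2)
    (HasFDerivAt.fun_smul (hasFDerivAt_fst) (hasFDerivAt_snd))
  rw [show (fun q : ℝ × EuclideanSpace ℝ (Fin n) => g (q.1 • q.2)) =
    g ∘ (fun q : ℝ × EuclideanSpace ℝ (Fin n) => q.1 • q.2) from rfl, h2.fderiv]
  simp

lemma fderiv_comp_smul' {n : ℕ} {g : EuclideanSpace ℝ (Fin n) → ℝ} (hg : ContDiff ℝ (⊤ : ℕ∞) g)
    (r : ℝ) (w v : EuclideanSpace ℝ (Fin n)) :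
    fderiv ℝ (fun w => g (r • w)) w v = r * fderiv ℝ g (r • w) v := by
  have hg1 : HasFDerivAt g (fderiv ℝ g (r • w)) (r • w) :=
    (hg.differentiable (by simp) _).hasFDerivAt
  have h2 := hg1.comp w (f := fun q : EuclideanSpace ℝ (Fin n) => r • q)
    ((hasFDerivAt_id w).const_smul r)
  rw [show (fun w => g (r • w)) = g ∘ (fun q : EuclideanSpace ℝ (Fin n) => r • q) from rfl,
    h2.fderiv]
  simp

lemma Jm_euler {n : ℕ} {g : EuclideanSpace ℝ (Fin n) → ℝ} (hg : ContDiff ℝ (⊤ : ℕ∞) g)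
    {θ θ' : ℝ → ℝ} (h : IsProf θ θ') (r : ℝ) :
    r * deriv (Jm g (fun w => θ (‖w‖ ^ 2))) r =
      - ∫ w, g (r • w) * (n * θ (‖w‖ ^ 2) + 2 * ‖w‖ ^ 2 * θ' (‖w‖ ^ 2)) := by
  have hg1 : ContDiff ℝ 1 (fun w => g (r • w)) := by
    have : ContDiff ℝ 1 g := hg.of_le (by simp)
    fun_prop
  rw [Jm_deriv hg h.wt, ← ibp2 h hg1, ← integral_const_mul]
  congr 1; ext w
  rw [fderiv_comp_smul' hg]; ring



/-- The one dimensional operator `r ∂_r + c`. -/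
def hE (c : ℝ) (φ : ℝ → ℝ) (r : ℝ) : ℝ := r * deriv φ r + c * φ r

/-- Iterated product of the operators `r ∂_r + c`. -/
def hop : List ℝ → (ℝ → ℝ) → ℝ → ℝ
  | [], φ => φ
  | c :: l, φ => hE c (hop l φ)

lemma contDiff_deriv' {φ : ℝ → ℝ} (h : ContDiff ℝ (⊤ : ℕ∞) φ) :
    ContDiff ℝ (⊤ : ℕ∞) (deriv φ) := by
  have := (contDiff_infty_iff_deriv (𝕜 := ℝ) (f := φ)).1 h
  exact this.2

lemma hE_contDiff (c : ℝ) {φ : ℝ → ℝ} (h : ContDiff ℝ (⊤ : ℕ∞) φ) :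
    ContDiff ℝ (⊤ : ℕ∞) (hE c φ) := by
  have := contDiff_deriv' h
  unfold hE
  fun_prop

lemma hop_contDiff (l : List ℝ) {φ : ℝ → ℝ} (h : ContDiff ℝ (⊤ : ℕ∞) φ) :
    ContDiff ℝ (⊤ : ℕ∞) (hop l φ) := by
  induction l with
  | nil => exact h
  | cons c l ih => exact hE_contDiff c ih

lemma hop_add (l : List ℝ) {φ ψ : ℝ → ℝ} (h : ContDiff ℝ (⊤ : ℕ∞) φ)
    (h' : ContDiff ℝ (⊤ : ℕ∞) ψ) :
    hop l (fun r => φ r + ψ r) = fun r => hop l φ r + hop l ψ r := by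
  induction l with
  | nil => rfl
  | cons c l ih =>
    ext r
    simp only [hop]
    rw [ih]
    unfold hE
    rw [deriv_fun_add ((hop_contDiff l h).differentiable (by simp) r)
      ((hop_contDiff l h').differentiable (by simp) r)]
    ring

lemma hop_poly (l : List ℝ) : ∃ a : ℕ → ℝ, (∀ i, l.length < i → a i = 0) ∧
    ∀ φ : ℝ → ℝ, ContDiff ℝ (⊤ : ℕ∞) φ → ∀ r,
      hop l φ r = ∑ i ∈ Finset.range (l.length + 1), a i * (r ^ i * iteratedDeriv i φ r) := by
  induction l with
  | nil =>
    refine ⟨fun i => if i = 0 then 1 else 0, ?_, ?_⟩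
    · intro i hi; simp at hi; simp; omega
    · intro φ hφ r; simp [hop]
  | cons c l ih =>
    obtain ⟨a, ha0, ha⟩ := ih
    refine ⟨fun i => (i + c) * a i + (match i with | 0 => 0 | k + 1 => a k), ?_, ?_⟩
    · intro i hi
      simp only [List.length_cons] at hi
      cases i with
      | zero => omega
      | succ k => simp [ha0 (k + 1) (by omega), ha0 k (by omega)]
    · intro φ hφ r
      have hd : ∀ i, HasDerivAt (iteratedDeriv i φ) (iteratedDeriv (i + 1) φ r) r := by
        intro i
        rw [iteratedDeriv_succ]
        exact ((hφ.differentiable_iteratedDeriv i (by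
          exact_mod_cast WithTop.coe_lt_top i)) r).hasDerivAt
      have h1 : HasDerivAt (hop l φ) (∑ i ∈ Finset.range (l.length + 1),
          a i * ((i * r ^ (i - 1)) * iteratedDeriv i φ r + r ^ i * iteratedDeriv (i + 1) φ r)) r := by
        rw [show hop l φ = fun r => _ from funext fun r => ha φ hφ r]
        apply HasDerivAt.fun_sum
        intro i _
        exact ((hasDerivAt_pow i r).mul (hd i)).const_mul (a i)
      simp only [hop, hE]
      rw [h1.deriv, ha φ hφ r, List.length_cons]
      simp only [add_mul, Finset.sum_add_distrib]
      rw [Finset.sum_range_succ' (fun i => (match i with | 0 => 0 | k + 1 => a k) *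
        (r ^ i * iteratedDeriv i φ r)) (l.length + 1)]
      rw [Finset.sum_range_succ (fun i => (i : ℝ) * a i * (r ^ i * iteratedDeriv i φ r))
        (l.length + 1), Finset.sum_range_succ (fun i => c * a i * (r ^ i * iteratedDeriv i φ r))
        (l.length + 1), ha0 (l.length + 1) (by omega)]
      simp only [mul_zero, zero_mul, add_zero]
      rw [Finset.mul_sum, Finset.mul_sum, ← Finset.sum_add_distrib, ← Finset.sum_add_distrib,
        ← Finset.sum_add_distrib]
      apply Finset.sum_congr rfl
      intro i _
      cases i with
      | zero => simp; ring
      | succ k => simp only [Nat.add_sub_cancel]; ring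

lemma hop_bound (l : List ℝ) : ∃ A : ℝ, 0 ≤ A ∧
    ∀ φ : ℝ → ℝ, ContDiff ℝ (⊤ : ℕ∞) φ → ∀ r,
      |hop l φ r| ≤ A * ∑ i ∈ Finset.range (l.length + 1), |r| ^ i * |iteratedDeriv i φ r| := by
  obtain ⟨a, -, ha⟩ := hop_poly l
  refine ⟨∑ i ∈ Finset.range (l.length + 1), |a i|, by positivity, ?_⟩
  intro φ hφ r
  rw [ha φ hφ r, Finset.mul_sum]
  refine (Finset.abs_sum_le_sum_abs _ _).trans ?_
  apply Finset.sum_le_sum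
  intro i hi
  rw [abs_mul, abs_mul, abs_pow]
  gcongr
  exact Finset.single_le_sum (f := fun i => |a i|) (fun i _ => abs_nonneg _) hi

lemma hop_zero_of {ε : ℝ} (l : List ℝ) {θ : ℝ → ℝ} (hz : ∀ q, 1 - ε < q → θ q = 0) :
    ∀ q, 1 - ε < q → hop l θ q = 0 := by
  induction l with
  | nil => exact hz
  | cons c l ih =>
    intro q hq
    simp only [hop, hE]
    rw [ih q hq]
    have : deriv (hop l θ) q = deriv (fun _ => (0:ℝ)) q := by
      apply Filter.EventuallyEq.deriv_eq
      filter_upwards [Ioi_mem_nhds hq] with x hx using ih x hx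
    rw [this]; simp

lemma isProf_of {ε : ℝ} (hε : 0 < ε) {θ : ℝ → ℝ} (hθ : ContDiff ℝ (⊤ : ℕ∞) θ)
    (hz : ∀ q, 1 - ε < q → θ q = 0) : IsProf θ (deriv θ) where
  hd q := (hθ.differentiable (by simp) q).hasDerivAt
  hc := (contDiff_deriv' hθ).continuous
  h0 q hq := hz q (by linarith)
  h0' q hq := by
    have : deriv θ q = deriv (fun _ => (0:ℝ)) q := by
      apply Filter.EventuallyEq.deriv_eq
      filter_upwards [Ioi_mem_nhds (show 1 - ε < q by linarith)] with x hx using hz x hx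
    rw [this]; simp

lemma hop_Jm {n : ℕ} {g : EuclideanSpace ℝ (Fin n) → ℝ} (hg : ContDiff ℝ (⊤ : ℕ∞) g)
    {ε : ℝ} (hε : 0 < ε) {θ : ℝ → ℝ} (hθ : ContDiff ℝ (⊤ : ℕ∞) θ)
    (hz : ∀ q, 1 - ε < q → θ q = 0) (l : List ℝ) :
    hop l (Jm g (fun w => θ (‖w‖ ^ 2))) = fun r => (-2) ^ l.length *
      Jm g (fun w => hop (l.map (fun c => (n - c) / 2)) θ (‖w‖ ^ 2)) r := by
  induction l with
  | nil => simp [hop]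
  | cons c l ih =>
    ext r
    simp only [hop, List.map_cons, List.length_cons]
    rw [ih]
    set θ₁ := hop (l.map (fun c => (n - c) / 2)) θ with hθ₁
    have hs : ContDiff ℝ (⊤ : ℕ∞) θ₁ := hop_contDiff _ hθ
    have hP := isProf_of hε hs (hop_zero_of _ hz)
    have hJ := Jm_contDiff hg (hP.wt (n := n))
    have := Jm_euler hg hP r
    unfold hE
    rw [deriv_const_mul _ (hJ.differentiable (by simp) r), mul_left_comm, this]
    unfold Jm
    beta_reduce
    rw [← integral_neg, ← integral_const_mul, ← integral_const_mul, ← integral_const_mul,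
      ← integral_const_mul, ← integral_add]
    · congr 1; ext w; ring
    · have cg := hg.continuous
      have a1 := hP.wt.integrable_mul (f := fun w => g (r • w)) (by fun_prop)
      have a2 := (rad_isWt hP.hc hP.h0').integrable_mul
        (f := fun w => g (r • w) * (2 * ‖w‖ ^ 2)) (by fun_prop)
      refine (((a1.const_mul (n:ℝ)).add a2).const_mul (-(-2)^l.length)).congr ?_
      filter_upwards with w
      simp; ring
    · have cg := hg.continuous
      exact ((hP.wt.integrable_mul (f := fun w => g (r • w)) (by fun_prop)).const_mul _).const_mul _

lemma param_iteratedDeriv {n : ℕ} {μ : EuclideanSpace ℝ (Fin n) → ℝ} (h : IsWt μ) (i : ℕ) :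
    ∀ {F : ℝ × EuclideanSpace ℝ (Fin n) → ℝ} (_ : ContDiff ℝ (⊤ : ℕ∞) F) (r : ℝ),
    iteratedDeriv i (fun r => ∫ w, F (r, w) * μ w) r =
      ∫ w, iteratedDeriv i (fun s => F (s, w)) r * μ w := by
  induction i with
  | zero => intro F hF r; simp
  | succ i ih =>
    intro F hF r
    have hF' : ContDiff ℝ (⊤ : ℕ∞) (fun q => fderiv ℝ F q ((1:ℝ), 0)) := by
      have := hF.fderiv_right (m := (⊤ : ℕ∞)) (by simp)
      fun_prop
    have e1 : deriv (fun r => ∫ w, F (r, w) * μ w) =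
        fun r => ∫ w, fderiv ℝ F (r, w) ((1:ℝ), 0) * μ w := by
      ext r
      rw [← fderiv_apply_one_eq_deriv, param_fderiv h hF]
    have e2 : ∀ w, deriv (fun s => F (s, w)) = fun s => fderiv ℝ F (s, w) ((1:ℝ), 0) := by
      intro w; ext s
      have h1 : HasFDerivAt F (fderiv ℝ F (s, w)) (s, w) :=
        (hF.differentiable (by simp) _).hasFDerivAt
      have h2 := h1.comp_hasDerivAt s ((hasDerivAt_id s).prodMk (hasDerivAt_const s w))
      exact h2.deriv
    simp only [iteratedDeriv_succ', e1, e2]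
    exact ih hF' r

lemma iteratedDeriv_ray_le {n : ℕ} {g : EuclideanSpace ℝ (Fin n) → ℝ}
    (hg : ContDiff ℝ (⊤ : ℕ∞) g) (i : ℕ) (w : EuclideanSpace ℝ (Fin n)) (r : ℝ) :
    |iteratedDeriv i (fun s : ℝ => g (s • w)) r| ≤ ‖iteratedFDeriv ℝ i g (r • w)‖ * ‖w‖ ^ i := by
  rw [← Real.norm_eq_abs, ← norm_iteratedFDeriv_eq_norm_iteratedDeriv]
  have := ContinuousLinearMap.iteratedFDeriv_comp_right
    (ContinuousLinearMap.toSpanSingleton ℝ w) (f := g) hg r (i := i)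
    (by exact_mod_cast le_top)
  have e : (fun s : ℝ => g (s • w)) = g ∘ (ContinuousLinearMap.toSpanSingleton ℝ w) := by
    ext s; simp
  rw [e, this]
  refine (ContinuousMultilinearMap.norm_compContinuousLinearMap_le _ _).trans ?_
  simp

lemma part1 {n : ℕ} (l : List ℝ) : ∃ A : ℝ, 0 ≤ A ∧ ∀ g : EuclideanSpace ℝ (Fin n) → ℝ,
    ContDiff ℝ (⊤ : ℕ∞) g → ∀ μ : EuclideanSpace ℝ (Fin n) → ℝ, IsWt μ → ∀ B : ℝ,
    (∀ w, |μ w| ≤ B) → ∀ r : ℝ, |hop l (Jm g μ) r| ≤ A * B *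
      ∑ i ∈ Finset.range (l.length + 1), |r| ^ i *
        ∫ w in Metric.ball (0 : EuclideanSpace ℝ (Fin n)) 1, ‖iteratedFDeriv ℝ i g (r • w)‖ := by
  obtain ⟨A, hA, h⟩ := hop_bound l
  refine ⟨A, hA, ?_⟩
  intro g hg μ hμ B hB r
  have hB0 : 0 ≤ B := (abs_nonneg _).trans (hB 0)
  refine (h _ (Jm_contDiff hg hμ) r).trans ?_
  rw [mul_assoc, Finset.mul_sum (a := B)]
  apply mul_le_mul_of_nonneg_left _ hA
  apply Finset.sum_le_sum
  intro i hi
  rw [mul_left_comm]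
  apply mul_le_mul_of_nonneg_left _ (by positivity)
  have e : iteratedDeriv i (Jm g μ) r = ∫ w, iteratedDeriv i (fun s : ℝ => g (s • w)) r * μ w :=
    param_iteratedDeriv hμ i (F := fun q : ℝ × EuclideanSpace ℝ (Fin n) => g (q.1 • q.2))
      (by fun_prop) r
  rw [e]
  have hcont : Continuous (fun w => ‖iteratedFDeriv ℝ i g (r • w)‖) := by
    have := hg.continuous_iteratedFDeriv (m := i) (by exact_mod_cast le_top)
    fun_prop
  rw [← integral_const_mul, ← integral_indicator Metric.isOpen_ball.measurableSet]
  have hint : Integrable ((Metric.ball (0 : EuclideanSpace ℝ (Fin n)) 1).indicator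
      (fun w => B * ‖iteratedFDeriv ℝ i g (r • w)‖)) := by
    rw [integrable_indicator_iff Metric.isOpen_ball.measurableSet]
    apply (IntegrableOn.mono_set (t := Metric.closedBall 0 1) _ Metric.ball_subset_closedBall)
    exact (by fun_prop : Continuous _).continuousOn.integrableOn_compact (isCompact_closedBall _ _)
  rw [← Real.norm_eq_abs]
  apply norm_integral_le_of_norm_le hint
  filter_upwards with w
  by_cases hw : w ∈ Metric.ball (0 : EuclideanSpace ℝ (Fin n)) 1
  · rw [Set.indicator_of_mem hw, norm_mul, mul_comm, Real.norm_eq_abs, Real.norm_eq_abs]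
    have h1 := iteratedDeriv_ray_le hg i w r
    have h2 : ‖w‖ ^ i ≤ 1 := pow_le_one₀ (norm_nonneg _) (mem_ball_zero_iff.1 hw).le
    have h3 := norm_nonneg (iteratedFDeriv ℝ i g (r • w))
    apply mul_le_mul (hB w) _ (abs_nonneg _) hB0
    nlinarith
  · rw [Set.indicator_of_notMem hw, hμ.2 w (by simpa using hw)]; simp



/-- Time derivative in the plane. -/
def dT (F : ℝ × ℝ → ℝ) (p : ℝ × ℝ) : ℝ := fderiv ℝ F p (1, 0)

/-- Radial derivative in the plane. -/
def dR (F : ℝ × ℝ → ℝ) (p : ℝ × ℝ) : ℝ := fderiv ℝ F p (0, 1)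

/-- The operator `r ∂_r + c` in the plane. -/
def h2 (c : ℝ) (F : ℝ × ℝ → ℝ) (p : ℝ × ℝ) : ℝ := p.2 * dR F p + c * F p

/-- Iterated product of the operators `r ∂_r + c` in the plane. -/
def h2L : List ℝ → (ℝ × ℝ → ℝ) → ℝ × ℝ → ℝ
  | [], F => F
  | c :: l, F => h2 c (h2L l F)

lemma dT_contDiff {F : ℝ × ℝ → ℝ} (h : ContDiff ℝ (⊤ : ℕ∞) F) : ContDiff ℝ (⊤ : ℕ∞) (dT F) := by
  have := h.fderiv_right (m := (⊤ : ℕ∞)) (by simp)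
  unfold dT; fun_prop

lemma dR_contDiff {F : ℝ × ℝ → ℝ} (h : ContDiff ℝ (⊤ : ℕ∞) F) : ContDiff ℝ (⊤ : ℕ∞) (dR F) := by
  have := h.fderiv_right (m := (⊤ : ℕ∞)) (by simp)
  unfold dR; fun_prop

lemma h2_contDiff (c : ℝ) {F : ℝ × ℝ → ℝ} (h : ContDiff ℝ (⊤ : ℕ∞) F) :
    ContDiff ℝ (⊤ : ℕ∞) (h2 c F) := by
  have := dR_contDiff h
  unfold h2; fun_prop

lemma h2L_contDiff (l : List ℝ) {F : ℝ × ℝ → ℝ} (h : ContDiff ℝ (⊤ : ℕ∞) F) :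
    ContDiff ℝ (⊤ : ℕ∞) (h2L l F) := by
  induction l with
  | nil => exact h
  | cons c l ih => exact h2_contDiff c ih

lemma dT_dR {F : ℝ × ℝ → ℝ} (h : ContDiff ℝ (⊤ : ℕ∞) F) : dT (dR F) = dR (dT F) := by
  ext p
  have hs : IsSymmSndFDerivAt ℝ F p := by
    apply (h.contDiffAt).isSymmSndFDerivAt
    rw [minSmoothness_of_isRCLikeNormedField]
    exact WithTop.coe_le_coe.2 (le_top : (2 : ℕ∞) ≤ ⊤)
  have hd : DifferentiableAt ℝ (fderiv ℝ F) p :=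
    (h.fderiv_right (m := (⊤ : ℕ∞)) (by simp)).differentiable (by simp) p
  unfold dT dR
  rw [fderiv_clm_apply hd (differentiableAt_const _),
    fderiv_clm_apply hd (differentiableAt_const _)]
  simpa using hs.eq (1, 0) (0, 1)

lemma hasFDerivAt_of {F : ℝ × ℝ → ℝ} (h : ContDiff ℝ (⊤ : ℕ∞) F) (p : ℝ × ℝ) :
    HasFDerivAt F (fderiv ℝ F p) p := (h.differentiable (by simp) p).hasFDerivAt

lemma hasDerivAt_r {F : ℝ × ℝ → ℝ} (h : ContDiff ℝ (⊤ : ℕ∞) F) (t r : ℝ) :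
    HasDerivAt (fun s => F (t, s)) (dR F (t, r)) r :=
  (hasFDerivAt_of h (t, r)).comp_hasDerivAt r ((hasDerivAt_const r t).prodMk (hasDerivAt_id r))

lemma hasDerivAt_t {F : ℝ × ℝ → ℝ} (h : ContDiff ℝ (⊤ : ℕ∞) F) (t r : ℝ) :
    HasDerivAt (fun s => F (s, r)) (dT F (t, r)) t :=
  (hasFDerivAt_of h (t, r)).comp_hasDerivAt t ((hasDerivAt_id t).prodMk (hasDerivAt_const t r))

lemma dR_eq {F : ℝ × ℝ → ℝ} (h : ContDiff ℝ (⊤ : ℕ∞) F) {t r d : ℝ}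
    (hd : HasDerivAt (fun s => F (t, s)) d r) : dR F (t, r) = d :=
  (hasDerivAt_r h t r).unique hd

lemma dT_eq {F : ℝ × ℝ → ℝ} (h : ContDiff ℝ (⊤ : ℕ∞) F) {t r d : ℝ}
    (hd : HasDerivAt (fun s => F (s, r)) d t) : dT F (t, r) = d :=
  (hasDerivAt_t h t r).unique hd

lemma dR_h2 (c : ℝ) {F : ℝ × ℝ → ℝ} (h : ContDiff ℝ (⊤ : ℕ∞) F) (p : ℝ × ℝ) :
    dR (h2 c F) p = p.2 * dR (dR F) p + (c + 1) * dR F p := by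
  obtain ⟨t, r⟩ := p
  apply dR_eq (h2_contDiff c h)
  have := ((hasDerivAt_id r).mul (hasDerivAt_r (dR_contDiff h) t r)).add
    ((hasDerivAt_r h t r).const_mul c)
  refine HasDerivAt.congr_deriv this ?_
  simp; ring

lemma dT_h2 (c : ℝ) {F : ℝ × ℝ → ℝ} (h : ContDiff ℝ (⊤ : ℕ∞) F) :
    dT (h2 c F) = h2 c (dT F) := by
  ext ⟨t, r⟩
  apply dT_eq (h2_contDiff c h)
  have := ((hasDerivAt_t (dR_contDiff h) t r).const_mul r).add
    ((hasDerivAt_t h t r).const_mul c)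
  refine HasDerivAt.congr_deriv this ?_
  simp only [h2, dT_dR h]

lemma dT_h2L (l : List ℝ) {F : ℝ × ℝ → ℝ} (h : ContDiff ℝ (⊤ : ℕ∞) F) :
    dT (h2L l F) = h2L l (dT F) := by
  induction l with
  | nil => rfl
  | cons c l ih => simp only [h2L]; rw [dT_h2 c (h2L_contDiff l h), ih]

lemma h2_slice (c : ℝ) {F : ℝ × ℝ → ℝ} (h : ContDiff ℝ (⊤ : ℕ∞) F) (t : ℝ) :
    (fun r => h2 c F (t, r)) = hE c (fun r => F (t, r)) := by
  ext r
  simp only [h2, hE]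
  rw [(hasDerivAt_r h t r).deriv]

lemma h2L_slice (l : List ℝ) {F : ℝ × ℝ → ℝ} (h : ContDiff ℝ (⊤ : ℕ∞) F) (t : ℝ) :
    (fun r => h2L l F (t, r)) = hop l (fun r => F (t, r)) := by
  induction l with
  | nil => rfl
  | cons c l ih => simp only [h2L, hop]; rw [h2_slice c (h2L_contDiff l h), ih]

/-- The Euler-Poisson-Darboux equation. -/
def EPD (c : ℝ) (G : ℝ × ℝ → ℝ) : Prop := ∀ p : ℝ × ℝ, 0 < p.1 →
  p.2 * dR (dR G) p + (c + 1) * dR G p = p.2 * dT (dT G) p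

lemma dR_congr {F K : ℝ × ℝ → ℝ} (h : ∀ p : ℝ × ℝ, 0 < p.1 → F p = K p) :
    ∀ p : ℝ × ℝ, 0 < p.1 → dR F p = dR K p := by
  intro p hp
  unfold dR
  have : F =ᶠ[nhds p] K := by
    filter_upwards [(isOpen_lt continuous_const continuous_fst).mem_nhds hp] with q hq
    exact h q hq
  rw [this.fderiv_eq]

lemma EPD_dR {c : ℝ} {G : ℝ × ℝ → ℝ} (hG : ContDiff ℝ (⊤ : ℕ∞) G) (h : EPD c G) :
    ∀ p : ℝ × ℝ, 0 < p.1 → dR (h2 c G) p = p.2 * dT (dT G) p := by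
  intro p hp
  rw [dR_h2 c hG, h p hp]

lemma EPD_dRR {c : ℝ} {G : ℝ × ℝ → ℝ} (hG : ContDiff ℝ (⊤ : ℕ∞) G) (h : EPD c G) :
    ∀ p : ℝ × ℝ, 0 < p.1 → dR (dR (h2 c G)) p = p.2 * dR (dT (dT G)) p + dT (dT G) p := by
  intro p hp
  rw [dR_congr (EPD_dR hG h) p hp]
  obtain ⟨t, r⟩ := p
  have c1 := dT_contDiff (dT_contDiff hG)
  apply dR_eq (by fun_prop)
  have := (hasDerivAt_id r).mul (hasDerivAt_r c1 t r)
  refine HasDerivAt.congr_deriv this ?_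
  simp; ring

lemma EPD_dTT {c : ℝ} {G : ℝ × ℝ → ℝ} (hG : ContDiff ℝ (⊤ : ℕ∞) G) (p : ℝ × ℝ) :
    dT (dT (h2 c G)) p = p.2 * dR (dT (dT G)) p + c * dT (dT G) p := by
  rw [dT_h2 c hG, dT_h2 c (dT_contDiff hG)]; rfl

lemma EPD_lower {c : ℝ} {G : ℝ × ℝ → ℝ} (hG : ContDiff ℝ (⊤ : ℕ∞) G) (h : EPD c G) :
    EPD (c - 2) (h2 c G) := by
  intro p hp
  rw [EPD_dRR hG h p hp, EPD_dR hG h p hp, EPD_dTT hG p]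
  ring

/-- The list of odd numbers `2 j + 1, …, 2 (j + k) - 1`. -/
def oddl : ℕ → ℕ → List ℝ
  | _, 0 => []
  | j, k + 1 => (2 * (j : ℝ) + 1) :: oddl (j + 1) k

lemma oddl_length (j k : ℕ) : (oddl j k).length = k := by
  induction k generalizing j with
  | zero => rfl
  | succ k ih => simp [oddl, ih]

lemma oddl_pos (j k : ℕ) : 0 < (oddl j k).prod := by
  induction k generalizing j with
  | zero => simp [oddl]
  | succ k ih => simp only [oddl, List.prod_cons]; have := ih (j + 1); positivity

lemma EPD_lowerL (k : ℕ) : ∀ (j : ℕ) {G : ℝ × ℝ → ℝ} (_ : ContDiff ℝ (⊤ : ℕ∞) G)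
    (_ : EPD (2 * ((j : ℝ) + k) - 1) G), EPD (2 * (j : ℝ) - 1) (h2L (oddl j k) G) := by
  induction k with
  | zero => intro j G hG h; simpa [oddl, h2L] using h
  | succ k ih =>
    intro j G hG h
    have h1 := ih (j + 1) hG (by convert h using 1; push_cast; ring)
    have h2 := EPD_lower (h2L_contDiff _ hG) (c := 2 * (j : ℝ) + 1) (by
      convert h1 using 1; push_cast; ring)
    simp only [oddl, h2L]
    convert h2 using 1; ring

lemma ext_zero {F K : ℝ × ℝ → ℝ} (hF : Continuous F) (hK : Continuous K)
    (h : ∀ p : ℝ × ℝ, 0 < p.1 → F p = K p) (p : ℝ × ℝ) (hp : 0 ≤ p.1) : F p = K p := by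
  rcases hp.lt_or_eq with hp | hp
  · exact h p hp
  obtain ⟨t, r⟩ := p
  simp only at hp
  subst hp
  have l1 : Filter.Tendsto (fun s : ℝ => F (s, r)) (nhdsWithin 0 (Set.Ioi 0)) (nhds (F (0, r))) :=
    ((by fun_prop : Continuous fun s : ℝ => F (s, r)).tendsto 0).mono_left nhdsWithin_le_nhds
  have l2 : Filter.Tendsto (fun s : ℝ => K (s, r)) (nhdsWithin 0 (Set.Ioi 0)) (nhds (K (0, r))) :=
    ((by fun_prop : Continuous fun s : ℝ => K (s, r)).tendsto 0).mono_left nhdsWithin_le_nhds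
  refine tendsto_nhds_unique (l1.congr' ?_) l2
  filter_upwards [self_mem_nhdsWithin] with s hs using h (s, r) hs

lemma const_on {φ φ' : ℝ → ℝ} {T : ℝ} (hT : 0 ≤ T)
    (hd : ∀ s, HasDerivAt φ (φ' s) s) (h0 : ∀ s, 0 ≤ s → s ≤ T → φ' s = 0) : φ T = φ 0 := by
  refine constant_of_has_deriv_right_zero (f := φ) (a := 0) (b := T) ?_ ?_ T ⟨hT, le_rfl⟩
  · exact fun s _ => (hd s).continuousAt.continuousWithinAt
  · intro s hs
    have := (hd s).hasDerivWithinAt (s := Set.Ici s)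
    rwa [h0 s hs.1 hs.2.le] at this

lemma dalembert {W : ℝ × ℝ → ℝ} (hW : ContDiff ℝ (⊤ : ℕ∞) W) (h : EPD 1 W) (T : ℝ) (hT : 0 ≤ T) :
    W (T, 0) = h2 1 W (0, T) + T * dT W (0, T) := by
  set V := h2 1 W with hV
  have sV : ContDiff ℝ (⊤ : ℕ∞) V := h2_contDiff 1 hW
  have sVt := dT_contDiff sV
  have sVr := dR_contDiff sV
  have sVtt := dT_contDiff sVt
  have sVrr := dR_contDiff sVr
  have sWt := dT_contDiff hW
  have sWtt := dT_contDiff sWt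
  have e1 : ∀ p : ℝ × ℝ, 0 ≤ p.1 → dR (dR V) p = dT (dT V) p :=
    ext_zero sVrr.continuous sVtt.continuous (fun p hp => by
      rw [EPD_dRR hW h p hp, EPD_dTT hW p]; ring)
  have e2 : ∀ p : ℝ × ℝ, 0 ≤ p.1 → dR V p = p.2 * dT (dT W) p :=
    ext_zero sVr.continuous (by have := sWtt.continuous; fun_prop) (EPD_dR hW h)
  have e3 : ∀ S, 0 ≤ S → dT V (S, 0) = dT V (0, S) + dR V (0, S) := by
    intro S hS
    have key := const_on (φ := fun s => dT V (s, S - s) + dR V (s, S - s))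
      (φ' := fun s => (dT (dT V) (s, S - s) - dR (dT V) (s, S - s)) +
        (dT (dR V) (s, S - s) - dR (dR V) (s, S - s))) hS ?_ ?_
    · simp only [sub_self, sub_zero] at key
      rw [e2 (S, 0) hS] at key
      simpa using key
    · intro s
      have lin : HasDerivAt (fun s : ℝ => (s, S - s)) ((1:ℝ), (-1:ℝ)) s :=
        (hasDerivAt_id s).prodMk ((hasDerivAt_id s).const_sub S)
      have aux : ∀ {F : ℝ × ℝ → ℝ}, ContDiff ℝ (⊤ : ℕ∞) F →
          HasDerivAt (fun s => F (s, S - s)) (dT F (s, S - s) - dR F (s, S - s)) s := by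
        intro F hF
        have := (hasFDerivAt_of hF (s, S - s)).comp_hasDerivAt s lin
        refine HasDerivAt.congr_deriv this ?_
        unfold dT dR
        rw [← map_sub]; simp
      exact (aux sVt).add (aux sVr)
    · intro s hs hs'
      rw [e1 _ hs, dT_dR sV]; ring
  have key := const_on (φ := fun s => V (s, 0) - (V (0, s) + s * dT W (0, s)))
      (φ' := fun s => dT V (s, 0) - (dR V (0, s) + (1 * dT W (0, s) + s * dR (dT W) (0, s)))) hT ?_ ?_
  · simp only [hV, h2] at key ⊢
    simp only [zero_mul, one_mul, zero_add, add_zero, sub_self] at key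
    linarith
  · intro s
    exact (hasDerivAt_t sV s 0).sub ((hasDerivAt_r sV 0 s).add
      ((hasDerivAt_id s).mul (hasDerivAt_r sWt 0 s)))
  · intro s hs _
    rw [e3 s hs, hV, dT_h2 1 hW]
    simp only [h2]; ring



/-- The profile `(1 - q)₊ ^ a`. -/
def pw (a q : ℝ) : ℝ := (max 0 (1 - q)) ^ a

lemma pw_zero {a q : ℝ} (ha : 0 < a) (hq : 1 ≤ q) : pw a q = 0 := by
  unfold pw
  rw [max_eq_left (by linarith), Real.zero_rpow ha.ne']

lemma pw_cont {a : ℝ} (ha : 0 < a) : Continuous (pw a) := by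
  unfold pw
  exact Continuous.rpow_const (by fun_prop) (fun _ => Or.inr ha.le)

lemma pw_wt {n : ℕ} {a : ℝ} (ha : 0 < a) :
    IsWt (fun w : EuclideanSpace ℝ (Fin n) => pw a (‖w‖ ^ 2)) :=
  rad_isWt (pw_cont ha) (fun _ hq => pw_zero ha hq)

lemma pos_rpow_hasDerivAt {a : ℝ} (ha : 0 < a) (y : ℝ) :
    HasDerivAt (fun y : ℝ => (max 0 y) ^ (a + 1)) ((a + 1) * (max 0 y) ^ a) y := by
  have hp : ∀ y : ℝ, HasDerivAt (fun y : ℝ => y ^ (a + 1)) ((a + 1) * y ^ a) y := by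
    intro y
    have := Real.hasDerivAt_rpow_const (x := y) (p := a + 1) (Or.inr (by linarith))
    simpa using this
  have h1 : ∀ y, 0 ≤ y → HasDerivWithinAt (fun y : ℝ => (max 0 y) ^ (a + 1))
      ((a + 1) * (max 0 y) ^ a) (Set.Ici 0) y := by
    intro y hy
    rw [max_eq_right hy]
    refine (hp y).hasDerivWithinAt.congr ?_ ?_
    · intro x hx; rw [max_eq_right hx]
    · rw [max_eq_right hy]
  have h2 : ∀ y, y ≤ 0 → HasDerivWithinAt (fun y : ℝ => (max 0 y) ^ (a + 1))
      ((a + 1) * (max 0 y) ^ a) (Set.Iic 0) y := by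
    intro y hy
    rw [max_eq_left hy, Real.zero_rpow ha.ne', mul_zero]
    refine (hasDerivWithinAt_const y _ (0:ℝ)).congr ?_ ?_
    · intro x hx; rw [max_eq_left hx, Real.zero_rpow (by linarith)]
    · rw [max_eq_left hy, Real.zero_rpow (by linarith)]
  rcases lt_trichotomy y 0 with hy | hy | hy
  · exact (h2 y hy.le).hasDerivAt (Iic_mem_nhds hy)
  · subst hy
    have := (h2 0 le_rfl).union (h1 0 le_rfl)
    rwa [Set.Iic_union_Ici, hasDerivWithinAt_univ] at this
  · exact (h1 y hy.le).hasDerivAt (Ici_mem_nhds hy)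

lemma pw_prof {a : ℝ} (ha : 0 < a) : IsProf (pw (a + 1)) (fun q => -((a + 1) * pw a q)) where
  hd q := by
    have := (pos_rpow_hasDerivAt ha (1 - q)).comp q ((hasDerivAt_id q).const_sub 1)
    refine HasDerivAt.congr_deriv this ?_
    unfold pw; ring
  hc := by have := pw_cont ha; fun_prop
  h0 q hq := pw_zero (by linarith) hq
  h0' q hq := by rw [pw_zero ha hq]; simp

lemma pw_succ {a : ℝ} (ha : 0 < a) {q : ℝ} (hq : 0 ≤ q) :
    q * pw a q = pw a q - pw (a + 1) q := by
  rcases le_or_gt 1 q with h | h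
  · rw [pw_zero ha h, pw_zero (by linarith) h]; simp
  · unfold pw
    rw [max_eq_right (by linarith), Real.rpow_add_one (by linarith)]
    ring

/-- Weighted average of a space-time function. -/
def Gm {n : ℕ} (u : ℝ × EuclideanSpace ℝ (Fin n) → ℝ) (μ : EuclideanSpace ℝ (Fin n) → ℝ)
    (p : ℝ × ℝ) : ℝ := ∫ w, u (p.1, p.2 • w) * μ w

lemma Gm_contDiff {n : ℕ} {u : ℝ × EuclideanSpace ℝ (Fin n) → ℝ} (hu : ContDiff ℝ (⊤ : ℕ∞) u)
    {μ : EuclideanSpace ℝ (Fin n) → ℝ} (hμ : IsWt μ) : ContDiff ℝ (⊤ : ℕ∞) (Gm u μ) :=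
  param_contDiff hμ
    (F := fun q : (ℝ × ℝ) × EuclideanSpace ℝ (Fin n) => u (q.1.1, q.1.2 • q.2)) (by fun_prop)

lemma wdt_contDiff {n : ℕ} {u : ℝ × EuclideanSpace ℝ (Fin n) → ℝ} (hu : ContDiff ℝ (⊤ : ℕ∞) u) :
    ContDiff ℝ (⊤ : ℕ∞) (wdt n u) := by
  have := hu.fderiv_right (m := (⊤ : ℕ∞)) (by simp)
  unfold wdt; fun_prop

lemma wdi_contDiff {n : ℕ} {u : ℝ × EuclideanSpace ℝ (Fin n) → ℝ} (hu : ContDiff ℝ (⊤ : ℕ∞) u)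
    (i : Fin n) : ContDiff ℝ (⊤ : ℕ∞) (wdi n i u) := by
  have := hu.fderiv_right (m := (⊤ : ℕ∞)) (by simp)
  unfold wdi; fun_prop

lemma Gm_fderiv {n : ℕ} {u : ℝ × EuclideanSpace ℝ (Fin n) → ℝ} (hu : ContDiff ℝ (⊤ : ℕ∞) u)
    {μ : EuclideanSpace ℝ (Fin n) → ℝ} (hμ : IsWt μ) (p v : ℝ × ℝ) :
    fderiv ℝ (Gm u μ) p v = ∫ w, fderiv ℝ u (p.1, p.2 • w) (v.1, v.2 • w) * μ w := by
  have := param_fderiv hμ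
    (F := fun q : (ℝ × ℝ) × EuclideanSpace ℝ (Fin n) => u (q.1.1, q.1.2 • q.2)) (by fun_prop) p v
  refine this.trans ?_
  congr 1; ext w; congr 1
  have h1 : HasFDerivAt u (fderiv ℝ u (p.1, p.2 • w)) (p.1, p.2 • w) :=
    (hu.differentiable (by simp) _).hasFDerivAt
  have hf : HasFDerivAt (fun q : (ℝ × ℝ) × EuclideanSpace ℝ (Fin n) => q.1)
    (ContinuousLinearMap.fst ℝ (ℝ × ℝ) (EuclideanSpace ℝ (Fin n))) (p, w) := hasFDerivAt_fst
  have hs : HasFDerivAt (fun q : (ℝ × ℝ) × EuclideanSpace ℝ (Fin n) => q.2)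
    (ContinuousLinearMap.snd ℝ (ℝ × ℝ) (EuclideanSpace ℝ (Fin n))) (p, w) := hasFDerivAt_snd
  have h2 := h1.comp (p, w) (f := fun q : (ℝ × ℝ) × EuclideanSpace ℝ (Fin n) =>
      (q.1.1, q.1.2 • q.2)) (hf.fst.prodMk (hf.snd.fun_smul hs))
  have h3 := h2.fderiv
  simp only [Function.comp_def] at h3
  rw [h3]
  simp

lemma Gm_dT {n : ℕ} {u : ℝ × EuclideanSpace ℝ (Fin n) → ℝ} (hu : ContDiff ℝ (⊤ : ℕ∞) u)
    {μ : EuclideanSpace ℝ (Fin n) → ℝ} (hμ : IsWt μ) :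
    dT (Gm u μ) = Gm (wdt n u) μ := by
  ext p
  unfold dT
  rw [Gm_fderiv hu hμ]
  simp [Gm, wdt]

lemma sum_single {n : ℕ} (w : EuclideanSpace ℝ (Fin n)) :
    w = ∑ i, w i • EuclideanSpace.single i (1:ℝ) := by
  ext j
  simp [Finset.sum_apply, Pi.single_apply]

lemma Gm_dR {n : ℕ} {u : ℝ × EuclideanSpace ℝ (Fin n) → ℝ} (hu : ContDiff ℝ (⊤ : ℕ∞) u)
    {μ : EuclideanSpace ℝ (Fin n) → ℝ} (hμ : IsWt μ) (p : ℝ × ℝ) :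
    dR (Gm u μ) p = ∑ i, ∫ w, wdi n i u (p.1, p.2 • w) * (w i * μ w) := by
  unfold dR
  rw [Gm_fderiv hu hμ, ← integral_finsetSum]
  · congr 1; ext w
    have e : ((0:ℝ), (1:ℝ) • w) = ∑ i, w i • ((0:ℝ), EuclideanSpace.single i (1:ℝ)) := by
      rw [one_smul]
      conv_lhs => rw [sum_single w]
      ext1
      · simp [Prod.fst_sum]
      · simp [Prod.snd_sum]
    simp only []
    rw [e, map_sum, Finset.sum_mul]
    apply Finset.sum_congr rfl
    intro i _
    rw [map_smul]
    simp [wdi]; ring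
  · intro i _
    have c := (wdi_contDiff hu i).continuous
    have := hμ.integrable_mul (f := fun w => wdi n i u (p.1, p.2 • w) * w i) (by fun_prop)
    simpa [mul_assoc] using this

lemma Gm_ii {n : ℕ} {u : ℝ × EuclideanSpace ℝ (Fin n) → ℝ} (hu : ContDiff ℝ (⊤ : ℕ∞) u)
    (hpde : ∀ p : ℝ × EuclideanSpace ℝ (Fin n), 0 < p.1 →
        wdt n (wdt n u) p = ∑ i, wdi n i (wdi n i u) p)
    {a : ℝ} (ha : 0 < a) (p : ℝ × ℝ) (hp : 0 < p.1) :
    2 * (a + 1) * dR (Gm u (fun w => pw a (‖w‖ ^ 2))) p =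
      p.2 * dT (dT (Gm u (fun w => pw (a + 1) (‖w‖ ^ 2)))) p := by
  have hP := pw_prof ha
  rw [Gm_dT hu hP.wt, Gm_dT (wdt_contDiff hu) hP.wt, Gm_dR hu (pw_wt ha)]
  unfold Gm
  have e : ∀ w : EuclideanSpace ℝ (Fin n), wdt n (wdt n u) (p.1, p.2 • w) =
      ∑ i, wdi n i (wdi n i u) (p.1, p.2 • w) := fun w => hpde _ hp
  simp only [e, Finset.sum_mul]
  rw [integral_finsetSum]
  · rw [Finset.mul_sum, Finset.mul_sum]
    apply Finset.sum_congr rfl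
    intro i _
    have c := wdi_contDiff hu i
    have hf : ContDiff ℝ (⊤ : ℕ∞) (fun x => wdi n i u (p.1, x)) := by fun_prop
    have h1 := ibp1 hP (f := fun w => wdi n i u (p.1, p.2 • w))
      (by exact (by fun_prop : ContDiff ℝ (⊤ : ℕ∞) _).of_le (by simp)) i
    have h2 : ∀ w, fderiv ℝ (fun w => wdi n i u (p.1, p.2 • w)) w (EuclideanSpace.single i 1) =
        p.2 * wdi n i (wdi n i u) (p.1, p.2 • w) := by
      intro w
      have := fderiv_comp_smul' hf p.2 w (EuclideanSpace.single i 1)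
      refine this.trans ?_
      congr 1
      have h1 : HasFDerivAt (wdi n i u) (fderiv ℝ (wdi n i u) (p.1, p.2 • w)) (p.1, p.2 • w) :=
        (c.differentiable (by simp) _).hasFDerivAt
      have h2 := h1.comp (p.2 • w) (f := fun x => (p.1, x))
        ((hasFDerivAt_const p.1 _).prodMk (hasFDerivAt_id _))
      have h3 := h2.fderiv
      simp only [Function.comp_def] at h3
      rw [h3]
      simp [wdi]
    simp only [h2] at h1
    rw [← integral_const_mul, ← integral_const_mul]
    simp only [← mul_assoc]
    rw [h1, ← integral_neg]
    congr 1; ext w; ring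
  · intro i _
    have c := (wdi_contDiff (wdi_contDiff hu i) i).continuous
    exact hP.wt.integrable_mul (f := fun w => wdi n i (wdi n i u) (p.1, p.2 • w)) (by fun_prop)

lemma Gm_i {n : ℕ} {u : ℝ × EuclideanSpace ℝ (Fin n) → ℝ} (hu : ContDiff ℝ (⊤ : ℕ∞) u)
    {a : ℝ} (ha : 0 < a) (han : 2 * a = n - 1) :
    h2 (2 * n + 1) (Gm u (fun w => pw (a + 1) (‖w‖ ^ 2))) =
      fun p => 2 * (a + 1) * Gm u (fun w => pw a (‖w‖ ^ 2)) p := by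
  have hP := pw_prof ha
  ext ⟨t, r⟩
  have h1 := Jm_euler (g := fun x => u (t, x)) (by fun_prop) hP r
  have h3 : deriv (Jm (fun x => u (t, x)) (fun w : EuclideanSpace ℝ (Fin n) =>
      pw (a + 1) (‖w‖ ^ 2))) r = dR (Gm u (fun w => pw (a + 1) (‖w‖ ^ 2))) (t, r) :=
    (hasDerivAt_r (Gm_contDiff hu hP.wt) t r).deriv
  rw [h3] at h1
  unfold h2
  simp only []
  rw [h1]
  unfold Gm
  simp only []
  have cu := hu.continuous
  have i1 := (hP.wt (n := n)).integrable_mul (f := fun w => u (t, r • w)) (by fun_prop)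
  have i2 := (pw_wt (n := n) ha).integrable_mul (f := fun w => u (t, r • w)) (by fun_prop)
  have e : ∀ w : EuclideanSpace ℝ (Fin n), u (t, r • w) * (n * pw (a + 1) (‖w‖ ^ 2) +
      2 * ‖w‖ ^ 2 * -((a + 1) * pw a (‖w‖ ^ 2))) =
      (2 * n + 1) * (u (t, r • w) * pw (a + 1) (‖w‖ ^ 2)) -
        2 * (a + 1) * (u (t, r • w) * pw a (‖w‖ ^ 2)) := by
    intro w
    have := pw_succ ha (sq_nonneg ‖w‖)
    have h : (n : ℝ) = 2 * a + 1 := by linarith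
    rw [h]
    linear_combination (-2 * (a + 1) * u (t, r • w)) * this
  simp only [e]
  rw [integral_sub (i1.const_mul _) (i2.const_mul _), integral_const_mul, integral_const_mul]
  ring

lemma Gm_EPD {n : ℕ} {u : ℝ × EuclideanSpace ℝ (Fin n) → ℝ} (hu : ContDiff ℝ (⊤ : ℕ∞) u)
    (hpde : ∀ p : ℝ × EuclideanSpace ℝ (Fin n), 0 < p.1 →
        wdt n (wdt n u) p = ∑ i, wdi n i (wdi n i u) p)
    {a : ℝ} (ha : 0 < a) (han : 2 * a = n - 1) :
    EPD (2 * n - 1) (Gm u (fun w => pw a (‖w‖ ^ 2))) := by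
  have hP := pw_prof ha
  set G := Gm u (fun w => pw a (‖w‖ ^ 2)) with hG
  set G' := Gm u (fun w => pw (a + 1) (‖w‖ ^ 2)) with hG'
  have sG : ContDiff ℝ (⊤ : ℕ∞) G := Gm_contDiff hu (pw_wt ha)
  have sG' : ContDiff ℝ (⊤ : ℕ∞) G' := Gm_contDiff hu hP.wt
  have s2 := dT_contDiff (dT_contDiff sG')
  have hii : ∀ p : ℝ × ℝ, 0 < p.1 → 2 * (a + 1) * dR G p = p.2 * dT (dT G') p := Gm_ii hu hpde ha
  have hi : h2 (2 * n + 1) G' = fun p => 2 * (a + 1) * G p := Gm_i hu ha han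
  have k1 : ∀ p : ℝ × ℝ, 0 < p.1 →
      2 * (a + 1) * dR (dR G) p = p.2 * dR (dT (dT G')) p + dT (dT G') p := by
    intro p hp
    have := dR_congr hii p hp
    have e1 : dR (fun p => 2 * (a + 1) * dR G p) p = 2 * (a + 1) * dR (dR G) p := by
      have c := dR_contDiff sG
      obtain ⟨t, r⟩ := p
      exact dR_eq (by fun_prop) ((hasDerivAt_r c t r).const_mul _)
    have e2 : dR (fun p => p.2 * dT (dT G') p) p = p.2 * dR (dT (dT G')) p + dT (dT G') p := by
      obtain ⟨t, r⟩ := p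
      apply dR_eq (by fun_prop)
      refine HasDerivAt.congr_deriv ((hasDerivAt_id r).mul (hasDerivAt_r s2 t r)) ?_
      simp; ring
    rw [← e1, this, e2]
  have k2 : ∀ p, 2 * (a + 1) * dT (dT G) p =
      p.2 * dR (dT (dT G')) p + (2 * n + 1) * dT (dT G') p := by
    intro p
    rw [← EPD_dTT sG', hi]
    have e1 : ∀ {F : ℝ × ℝ → ℝ}, ContDiff ℝ (⊤ : ℕ∞) F →
        dT (fun p => 2 * (a + 1) * F p) = fun p => 2 * (a + 1) * dT F p := by
      intro F hF
      ext ⟨t, r⟩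
      exact dT_eq (by fun_prop) ((hasDerivAt_t hF t r).const_mul _)
    rw [e1 sG, e1 (dT_contDiff sG)]
  intro p hp
  have h0 : 2 * (a + 1) ≠ 0 := by positivity
  apply mul_left_cancel₀ h0
  linear_combination p.2 * k1 p hp + (2 * n) * hii p hp - p.2 * k2 p

lemma h2L_zero (l : List ℝ) (F : ℝ × ℝ → ℝ) (t : ℝ) : h2L l F (t, 0) = l.prod * F (t, 0) := by
  induction l with
  | nil => simp [h2L]
  | cons c l ih => simp [h2L, h2, ih, mul_assoc]

lemma repr_formula {n : ℕ} (hn : 2 ≤ n) {u : ℝ × EuclideanSpace ℝ (Fin n) → ℝ}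
    (hu : ContDiff ℝ (⊤ : ℕ∞) u)
    (hpde : ∀ p : ℝ × EuclideanSpace ℝ (Fin n), 0 < p.1 →
        wdt n (wdt n u) p = ∑ i, wdi n i (wdi n i u) p)
    {a : ℝ} (ha : 0 < a) (han : 2 * a = n - 1) {T : ℝ} (hT : 0 ≤ T) :
    (oddl 1 (n - 1)).prod * (u (T, 0) * ∫ w : EuclideanSpace ℝ (Fin n), pw a (‖w‖ ^ 2)) =
      hop (oddl 0 n) (Jm (fun x => u (0, x)) (fun w => pw a (‖w‖ ^ 2))) T +
      T * hop (oddl 1 (n - 1)) (Jm (fun x => wdt n u (0, x)) (fun w => pw a (‖w‖ ^ 2))) T := by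
  have hE := Gm_EPD hu hpde ha han
  obtain ⟨k, rfl⟩ : ∃ k, n = k + 1 := ⟨n - 1, by omega⟩
  have hwt := pw_wt (n := k + 1) ha
  set G := Gm u (fun w => pw a (‖w‖ ^ 2)) with hG
  have sG : ContDiff ℝ (⊤ : ℕ∞) G := Gm_contDiff hu (pw_wt ha)
  have h1 := EPD_lowerL k 1 sG (by convert hE using 1; push_cast; ring)
  have h2 := dalembert (h2L_contDiff _ sG) (by convert h1 using 1; norm_num) T hT
  rw [h2L_zero] at h2
  have e0 : G (T, 0) = u (T, 0) * ∫ w : EuclideanSpace ℝ (Fin (k + 1)), pw a (‖w‖ ^ 2) := by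
    rw [hG]; unfold Gm
    simp [integral_const_mul]
  have e1 : _root_.h2 1 (h2L (oddl 1 k) G) (0, T) =
      hop (oddl 0 (k + 1)) (Jm (fun x => u (0, x)) (fun w => pw a (‖w‖ ^ 2))) T := by
    have := congrFun (h2L_slice (oddl 0 (k + 1)) sG 0) T
    simp only [oddl, h2L] at this ⊢
    norm_num at this ⊢
    exact this
  have e2 : dT (h2L (oddl 1 k) G) (0, T) =
      hop (oddl 1 k) (Jm (fun x => wdt (k + 1) u (0, x)) (fun w => pw a (‖w‖ ^ 2))) T := by
    rw [dT_h2L _ sG, hG, Gm_dT hu hwt]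
    exact congrFun (h2L_slice (oddl 1 k) (Gm_contDiff (wdt_contDiff hu) hwt) 0) T
  rw [e0, e1, e2] at h2
  exact h2



/-- A smooth modification of `x ^ a`, vanishing for `x ≤ 1`. -/
def Th (a x : ℝ) : ℝ := Real.smoothTransition (x - 1) * x ^ a

lemma Th_zero {a x : ℝ} (hx : x ≤ 1) : Th a x = 0 := by
  unfold Th; rw [Real.smoothTransition.zero_of_nonpos (by linarith), zero_mul]

lemma Th_eq {a x : ℝ} (hx : 2 ≤ x) : Th a x = x ^ a := by
  unfold Th; rw [Real.smoothTransition.one_of_one_le (by linarith), one_mul]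

lemma Th_contDiff (a : ℝ) : ContDiff ℝ (⊤ : ℕ∞) (Th a) := by
  rw [contDiff_iff_contDiffAt]
  intro x
  rcases lt_or_ge x 1 with h | h
  · have : Th a =ᶠ[nhds x] fun _ => 0 := by
      filter_upwards [Iio_mem_nhds h] with y hy using Th_zero (le_of_lt hy)
    exact contDiffAt_const.congr_of_eventuallyEq this
  · have h1 : ContDiffAt ℝ (⊤ : ℕ∞) (fun x : ℝ => x ^ a) x :=
      contDiffAt_id.rpow_const_of_ne (by simp; linarith)
    have h2 : ContDiff ℝ (⊤ : ℕ∞) (fun x : ℝ => Real.smoothTransition (x - 1)) :=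
      Real.smoothTransition.contDiff.comp (by fun_prop)
    exact h2.contDiffAt.mul h1

lemma Th_bound (a : ℝ) (i : ℕ) : ∃ K : ℝ, 0 ≤ K ∧ ∀ δ : ℝ, 0 < δ → δ ≤ 1 → ∀ x : ℝ, 0 ≤ x →
    x ≤ δ⁻¹ → |iteratedDeriv i (Th a) x| ≤ K * δ ^ (min ((i : ℝ) - a) 0) := by
  have hc : Continuous (iteratedDeriv i (Th a)) :=
    (Th_contDiff a).continuous_iteratedDeriv i (by exact_mod_cast le_top)
  obtain ⟨K, hK⟩ := (isCompact_Icc (a := (0:ℝ)) (b := 2)).exists_bound_of_continuousOn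
    hc.continuousOn
  have hK0 : 0 ≤ K := (norm_nonneg _).trans (hK 0 (by simp))
  set D := |(descPochhammer ℝ i).eval a| with hD
  refine ⟨max K D, le_max_of_le_left hK0, ?_⟩
  intro δ hδ hδ1 x hx hxd
  have h1 : 1 ≤ δ ^ (min ((i : ℝ) - a) 0) :=
    Real.one_le_rpow_of_pos_of_le_one_of_nonpos hδ hδ1 (min_le_right _ _)
  rcases le_or_gt x 2 with h | h
  · have := hK x ⟨hx, h⟩
    rw [Real.norm_eq_abs] at this
    have h2 := le_max_left K D
    nlinarith
  · have e : iteratedDeriv i (Th a) x = (descPochhammer ℝ i).eval a * x ^ (a - i) := by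
      rw [← Real.iter_deriv_rpow_const, ← iteratedDeriv_eq_iterate]
      refine Filter.EventuallyEq.iteratedDeriv_eq i ?_
      filter_upwards [Ioi_mem_nhds h] with y hy using Th_eq (le_of_lt hy)
    rw [e, abs_mul, abs_of_nonneg (Real.rpow_nonneg hx _)]
    apply mul_le_mul (le_max_right _ _) _ (Real.rpow_nonneg hx _) (le_max_of_le_left hK0)
    rcases le_or_gt a i with hi | hi
    · exact (Real.rpow_le_one_of_one_le_of_nonpos (by linarith) (by linarith)).trans h1
    · rw [min_eq_left (by linarith)]
      refine (Real.rpow_le_rpow hx hxd (by linarith)).trans_eq ?_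
      rw [Real.inv_rpow hδ.le, ← Real.rpow_neg hδ.le]
      congr 1; ring

lemma iteratedDeriv_affine {F : ℝ → ℝ} (hF : ContDiff ℝ (⊤ : ℕ∞) F) (A α β : ℝ) (i : ℕ) :
    iteratedDeriv i (fun q => A * F (α * q + β)) =
      fun q => A * α ^ i * iteratedDeriv i F (α * q + β) := by
  induction i with
  | zero => simp
  | succ i ih =>
    rw [iteratedDeriv_succ, ih, iteratedDeriv_succ]
    ext q
    have h1 : HasDerivAt (iteratedDeriv i F) (deriv (iteratedDeriv i F) (α * q + β)) (α * q + β) :=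
      ((hF.differentiable_iteratedDeriv i (by exact_mod_cast WithTop.coe_lt_top i)) _).hasDerivAt
    have h2 : HasDerivAt (fun q => α * q + β) α q := by
      simpa using ((hasDerivAt_id q).const_mul α).add_const β
    have h3 := (h1.comp q h2).const_mul (A * α ^ i)
    refine (h3.deriv).trans ?_
    ring

lemma theta_exists {a : ℝ} (ha : 0 < a) (l : List ℝ) (hal : a ≤ l.length) :
    ∃ C : ℝ, 0 ≤ C ∧ ∀ δ : ℝ, 0 < δ → δ ≤ 1 → ∃ θ : ℝ → ℝ, ContDiff ℝ (⊤ : ℕ∞) θ ∧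
      (∀ q, 1 - δ < q → θ q = 0) ∧ (∀ q, |pw a q - θ q| ≤ C * δ ^ a) ∧
      (∀ q, 0 ≤ q → q ≤ 1 → |hop l θ q| ≤ C * δ ^ (a - l.length)) := by
  obtain ⟨A, hA, hAb⟩ := hop_bound l
  choose K hK hKb using Th_bound a
  set S := A * ∑ i ∈ Finset.range (l.length + 1), K i with hS
  have hS0 : 0 ≤ S := mul_nonneg hA (Finset.sum_nonneg fun i _ => hK i)
  refine ⟨max (2 ^ a) S, le_max_of_le_right hS0, ?_⟩
  intro δ hδ hδ1
  have hda : 0 ≤ δ ^ a := Real.rpow_nonneg hδ.le a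
  have sTh := Th_contDiff a
  have hs : ContDiff ℝ (⊤ : ℕ∞) (fun q => δ ^ a * Th a (-δ⁻¹ * q + δ⁻¹)) := by
    have : ContDiff ℝ (⊤ : ℕ∞) (fun q => Th a (-δ⁻¹ * q + δ⁻¹)) := sTh.comp (by fun_prop)
    fun_prop
  have hx : ∀ q, -δ⁻¹ * q + δ⁻¹ = (1 - q) / δ := by intro q; field_simp; ring
  refine ⟨_, hs, ?_, ?_, ?_⟩
  · intro q hq
    rw [hx, Th_zero, mul_zero]
    rw [div_le_one hδ]; linarith
  · intro q
    rw [hx]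
    set x := (1 - q) / δ with hxd
    have hq : 1 - q = δ * x := by rw [hxd]; field_simp
    have key : |(max 0 x) ^ a - Th a x| ≤ 2 ^ a := by
      rcases le_or_gt 2 x with h | h
      · rw [Th_eq h, max_eq_right (by linarith)]; simp; positivity
      · have h3 : (max 0 x) ^ a ≤ 2 ^ a := by
          apply Real.rpow_le_rpow (le_max_left _ _) _ ha.le
          exact max_le (by norm_num) h.le
        have h3' : 0 ≤ (max 0 x) ^ a := Real.rpow_nonneg (le_max_left _ _) _
        have h4 : 0 ≤ Th a x ∧ Th a x ≤ 2 ^ a := by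
          rcases le_or_gt x 1 with h' | h'
          · rw [Th_zero h']; exact ⟨le_rfl, by positivity⟩
          · have b1 := Real.smoothTransition.nonneg (x - 1)
            have b2 := Real.smoothTransition.le_one (x - 1)
            rw [max_eq_right (by linarith)] at h3 h3'
            unfold Th
            exact ⟨by positivity, by nlinarith⟩
        rw [abs_le]; constructor <;> linarith [h4.1, h4.2]
    have e : pw a q = δ ^ a * (max 0 x) ^ a := by
      unfold pw
      rw [hq, ← Real.mul_rpow hδ.le (le_max_left _ _)]
      congr 1
      rw [mul_max_of_nonneg _ _ hδ.le, mul_zero]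
    rw [e, ← mul_sub, abs_mul, abs_of_nonneg hda, mul_comm]
    exact mul_le_mul_of_nonneg_right (key.trans (le_max_left _ _)) hda
  · intro q hq0 hq1
    refine (hAb _ hs q).trans ?_
    have hdd : 0 ≤ δ ^ (a - l.length) := Real.rpow_nonneg hδ.le _
    refine le_trans ?_ (mul_le_mul_of_nonneg_right (le_max_right _ _) hdd)
    rw [hS, mul_assoc, Finset.sum_mul]
    apply mul_le_mul_of_nonneg_left _ hA
    apply Finset.sum_le_sum
    intro i hi
    rw [iteratedDeriv_affine sTh]
    simp only []
    have hi' : (i : ℝ) ≤ l.length := by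
      have := Finset.mem_range.1 hi
      exact_mod_cast (by omega : i ≤ l.length)
    have b1 : |q| ^ i ≤ 1 := pow_le_one₀ (abs_nonneg _) (by rwa [abs_of_nonneg hq0])
    have b2 := hKb i δ hδ hδ1 (-δ⁻¹ * q + δ⁻¹)
      (by rw [hx]; exact div_nonneg (by linarith) hδ.le)
      (by have : 0 < δ⁻¹ := by positivity
          nlinarith)
    have b3 : |δ ^ a * (-δ⁻¹) ^ i| = δ ^ (a - i) := by
      rw [abs_mul, abs_of_nonneg hda, abs_pow, abs_neg, abs_of_pos (by positivity : 0 < δ⁻¹),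
        inv_pow, Real.rpow_sub hδ, Real.rpow_natCast, div_eq_mul_inv]
    rw [abs_mul, b3]
    have b4 : δ ^ (a - i) * δ ^ (min ((i : ℝ) - a) 0) ≤ δ ^ (a - l.length) := by
      rw [← Real.rpow_add hδ]
      apply Real.rpow_le_rpow_of_exponent_ge hδ hδ1
      rcases min_choice ((i : ℝ) - a) 0 with h | h <;> rw [h] <;> linarith
    have b5 : 0 ≤ δ ^ (a - (i:ℝ)) := Real.rpow_nonneg hδ.le _
    calc |q| ^ i * (δ ^ (a - (i:ℝ)) * |iteratedDeriv i (Th a) (-δ⁻¹ * q + δ⁻¹)|)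
        ≤ 1 * (δ ^ (a - (i:ℝ)) * (K i * δ ^ (min ((i : ℝ) - a) 0))) := by gcongr
      _ = K i * (δ ^ (a - (i:ℝ)) * δ ^ (min ((i : ℝ) - a) 0)) := by ring
      _ ≤ _ := mul_le_mul_of_nonneg_left b4 (hK i)



lemma line_bound {n : ℕ} {X : Type*} [NormedAddCommGroup X] [NormedSpace ℝ X]
    {h : EuclideanSpace ℝ (Fin n) → X} (hh : ContDiff ℝ 1 h) (hc : HasCompactSupport h)
    (i : Fin n) (y : EuclideanSpace ℝ (Fin n)) :
    ‖h y‖ₑ ≤ ∫⁻ s : ℝ, ‖fderiv ℝ h (y + s • EuclideanSpace.single i (1:ℝ))‖ₑ := by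
  set v := EuclideanSpace.single i (1:ℝ) with hv
  have hvn : ‖v‖ = 1 := by simp [hv]
  obtain ⟨R, hR⟩ := hc.isCompact.isBounded.subset_closedBall 0
  have hk : HasCompactSupport (fun s : ℝ => h (y + s • v)) := by
    apply HasCompactSupport.intro (isCompact_Icc (a := -(R + ‖y‖)) (b := R + ‖y‖))
    intro s hs
    by_contra hne
    apply hs
    have h1 := hR (subset_tsupport h hne)
    rw [mem_closedBall_zero_iff] at h1
    have h2 : ‖s • v‖ ≤ ‖y + s • v‖ + ‖y‖ := by
      have := norm_sub_le (y + s • v) y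
      simpa using this
    rw [norm_smul, hvn, mul_one, Real.norm_eq_abs] at h2
    exact abs_le.1 (by linarith)
  have h1 := HasCompactSupport.enorm_le_lintegral_Ici_deriv
    (f := fun s : ℝ => h (y + s • v)) (by fun_prop) hk 0
  simp only [zero_smul, add_zero] at h1
  refine h1.trans ((setLIntegral_le_lintegral _ _).trans (lintegral_mono fun s => ?_))
  have hd : HasDerivAt (fun s : ℝ => h (y + s • v)) (fderiv ℝ h (y + s • v) v) s := by
    have a1 : HasFDerivAt h (fderiv ℝ h (y + s • v)) (y + s • v) :=
      (hh.differentiable one_ne_zero _).hasFDerivAt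
    have a2 : HasDerivAt (fun s : ℝ => y + s • v) v s := by
      simpa using ((hasDerivAt_id s).smul_const v).const_add y
    exact a1.comp_hasDerivAt s a2
  rw [hd.deriv]
  refine (ContinuousLinearMap.le_opENorm _ _).trans ?_
  have : ‖v‖ₑ = 1 := by rw [← ofReal_norm, hvn]; simp
  rw [this, mul_one]

lemma slab_step {n : ℕ} {F : EuclideanSpace ℝ (Fin n) → ℝ≥0∞} (hF : Measurable F)
    {A : Set (EuclideanSpace ℝ (Fin n))} (hA : MeasurableSet A) (i : Fin n)
    (hinv : ∀ y (s : ℝ), y + s • EuclideanSpace.single i (1:ℝ) ∈ A ↔ y ∈ A) (T : ℝ) :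
    ∫⁻ y in A ∩ {y | |y i| ≤ T}, ∫⁻ s : ℝ, F (y + s • EuclideanSpace.single i (1:ℝ)) =
      ENNReal.ofReal (2 * T) * ∫⁻ y in A, F y := by
  set v := EuclideanSpace.single i (1:ℝ) with hv
  set k : ℝ → ℝ≥0∞ := (Set.Icc (-T) T).indicator (fun _ => 1) with hk
  have mk : Measurable k := measurable_const.indicator measurableSet_Icc
  set φ : EuclideanSpace ℝ (Fin n) → ℝ≥0∞ := A.indicator F with hφ
  have mφ : Measurable φ := hF.indicator hA
  have mi : Measurable (fun y : EuclideanSpace ℝ (Fin n) => y i) := by fun_prop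
  have mS : MeasurableSet {y : EuclideanSpace ℝ (Fin n) | |y i| ≤ T} :=
    measurableSet_le (by fun_prop) measurable_const
  have e1 : ∀ y, (A ∩ {y | |y i| ≤ T}).indicator (fun y => ∫⁻ s : ℝ, F (y + s • v)) y =
      ∫⁻ s : ℝ, k (y i) * φ (y + s • v) := by
    intro y
    by_cases h1 : y ∈ A
    · by_cases h2 : |y i| ≤ T
      · rw [Set.indicator_of_mem (show y ∈ A ∩ {y | |y i| ≤ T} from ⟨h1, h2⟩)]
        congr 1; ext s
        rw [hk, Set.indicator_of_mem (Set.mem_Icc.2 (abs_le.1 h2)), hφ,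
          Set.indicator_of_mem ((hinv y s).2 h1), one_mul]
      · rw [Set.indicator_of_notMem (fun h => h2 h.2)]
        have : k (y i) = 0 :=
          Set.indicator_of_notMem (fun h => h2 (abs_le.2 (Set.mem_Icc.1 h))) _
        simp [this]
    · rw [Set.indicator_of_notMem (fun h => h1 h.1)]
      have : ∀ s : ℝ, φ (y + s • v) = 0 := fun s =>
        Set.indicator_of_notMem (fun h => h1 ((hinv y s).1 h)) _
      simp [this]
  rw [← lintegral_indicator (hA.inter mS), ← lintegral_indicator hA]
  simp only [e1]
  rw [lintegral_lintegral_swap (by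
    apply Measurable.aemeasurable
    simp only [Function.uncurry_def]
    have : Measurable (fun a : EuclideanSpace ℝ (Fin n) × ℝ => a.1 + a.2 • v) := by fun_prop
    exact (mk.comp (mi.comp measurable_fst)).mul (mφ.comp this))]
  have e2 : ∀ s : ℝ, ∫⁻ y, k (y i) * φ (y + s • v) = ∫⁻ y, k (y i - s) * φ y := by
    intro s
    rw [← lintegral_add_right_eq_self (fun y => k (y i - s) * φ y) (s • v)]
    congr 1; ext y
    simp [hv]
  simp only [e2]
  rw [lintegral_lintegral_swap (by
    apply Measurable.aemeasurable
    simp only [Function.uncurry_def]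
    have : Measurable (fun a : ℝ × EuclideanSpace ℝ (Fin n) => a.2 i - a.1) := by fun_prop
    exact (mk.comp this).mul (mφ.comp measurable_snd)), ← lintegral_const_mul _ mφ]
  congr 1; ext y
  rw [lintegral_mul_const _ (show Measurable (fun x => k (y i - x)) from mk.comp (by fun_prop))]
  congr 1
  rw [lintegral_sub_left_eq_self k (y i), hk, lintegral_indicator measurableSet_Icc]
  rw [setLIntegral_const, one_mul, Real.volume_Icc]
  congr 1; ring

lemma slab {n : ℕ} {g : EuclideanSpace ℝ (Fin n) → ℝ} (hg : ContDiff ℝ (⊤ : ℕ∞) g)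
    (hc : HasCompactSupport g) (T : ℝ) (I : Finset (Fin n)) : ∀ j : ℕ,
    ∫⁻ y in {y | ∀ i ∈ I, |y i| ≤ T}, ‖iteratedFDeriv ℝ j g y‖ₑ ≤
      ENNReal.ofReal (2 * T) ^ I.card * ∫⁻ y, ‖iteratedFDeriv ℝ (j + I.card) g y‖ₑ := by
  induction I using Finset.induction_on with
  | empty => intro j; simp; rfl
  | insert i I hi ih =>
    intro j
    set A := {y : EuclideanSpace ℝ (Fin n) | ∀ i ∈ I, |y i| ≤ T} with hA
    have mA : MeasurableSet A := by
      have : A = ⋂ i ∈ I, {y : EuclideanSpace ℝ (Fin n) | |y i| ≤ T} := by ext; simp [hA]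
      rw [this]
      exact Finset.measurableSet_biInter I fun i _ =>
        measurableSet_le (by fun_prop) measurable_const
    have eA : {y : EuclideanSpace ℝ (Fin n) | ∀ k ∈ insert i I, |y k| ≤ T} =
        A ∩ {y | |y i| ≤ T} := by
      ext y; simp [hA, and_comm]
    have hh : ContDiff ℝ 1 (iteratedFDeriv ℝ j g) :=
      hg.iteratedFDeriv_right (by
        have : ((1 + j : ℕ) : ℕ∞) ≤ ⊤ := le_top
        exact_mod_cast WithTop.coe_le_coe.2 this)
    have hm : Measurable (fun y => ‖fderiv ℝ (iteratedFDeriv ℝ j g) y‖ₑ) :=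
      (hh.continuous_fderiv one_ne_zero).enorm.measurable
    rw [eA]
    calc ∫⁻ y in A ∩ {y | |y i| ≤ T}, ‖iteratedFDeriv ℝ j g y‖ₑ
        ≤ ∫⁻ y in A ∩ {y | |y i| ≤ T}, ∫⁻ s : ℝ,
          ‖fderiv ℝ (iteratedFDeriv ℝ j g) (y + s • EuclideanSpace.single i (1:ℝ))‖ₑ :=
          lintegral_mono fun y => line_bound hh (hc.iteratedFDeriv j) i y
      _ = ENNReal.ofReal (2 * T) * ∫⁻ y in A, ‖fderiv ℝ (iteratedFDeriv ℝ j g) y‖ₑ := by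
          refine slab_step hm mA i ?_ T
          intro y s
          simp only [hA, Set.mem_ofPred_eq]
          refine forall₂_congr fun k hk => ?_
          have : k ≠ i := fun h => hi (h ▸ hk)
          simp [this]
      _ = ENNReal.ofReal (2 * T) * ∫⁻ y in A, ‖iteratedFDeriv ℝ (j + 1) g y‖ₑ := by
          congr 2; ext y
          rw [← ofReal_norm, ← ofReal_norm, norm_fderiv_iteratedFDeriv]
      _ ≤ ENNReal.ofReal (2 * T) * (ENNReal.ofReal (2 * T) ^ I.card *
            ∫⁻ y, ‖iteratedFDeriv ℝ (j + 1 + I.card) g y‖ₑ) := by gcongr; exact ih (j + 1)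
      _ = _ := by
          rw [Finset.card_insert_of_notMem hi, pow_succ', mul_assoc,
            show j + 1 + I.card = j + (I.card + 1) by ring]

/-- The `L¹` norm of the `i`-th derivative. -/
def Ln {n : ℕ} (i : ℕ) (g : EuclideanSpace ℝ (Fin n) → ℝ) : ℝ := ∫ y, ‖iteratedFDeriv ℝ i g y‖

lemma Ln_nonneg {n : ℕ} (i : ℕ) (g : EuclideanSpace ℝ (Fin n) → ℝ) : 0 ≤ Ln i g :=
  integral_nonneg fun _ => norm_nonneg _

lemma Ln_int {n : ℕ} {g : EuclideanSpace ℝ (Fin n) → ℝ} (hg : ContDiff ℝ (⊤ : ℕ∞) g)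
    (hc : HasCompactSupport g) (i : ℕ) : Integrable (iteratedFDeriv ℝ i g) :=
  (hg.continuous_iteratedFDeriv (m := i) (by exact_mod_cast le_top)).integrable_of_hasCompactSupport
    (hc.iteratedFDeriv i)

lemma ball_le {n : ℕ} {g : EuclideanSpace ℝ (Fin n) → ℝ} (hg : ContDiff ℝ (⊤ : ℕ∞) g)
    (hc : HasCompactSupport g) (i : ℕ) (T : ℝ) :
    ∫ y in Metric.ball (0 : EuclideanSpace ℝ (Fin n)) T, ‖iteratedFDeriv ℝ i g y‖ ≤ Ln i g :=
  setIntegral_le_integral (Ln_int hg hc i).norm (Filter.Eventually.of_forall fun _ => norm_nonneg _)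

lemma ball_slab {n : ℕ} {g : EuclideanSpace ℝ (Fin n) → ℝ} (hg : ContDiff ℝ (⊤ : ℕ∞) g)
    (hc : HasCompactSupport g) {T : ℝ} (hT : 0 ≤ T) {i m : ℕ} (him : i ≤ m) (hmn : m ≤ n) :
    ∫ y in Metric.ball (0 : EuclideanSpace ℝ (Fin n)) T, ‖iteratedFDeriv ℝ i g y‖ ≤
      (2 * T) ^ (m - i) * Ln m g := by
  obtain ⟨I, hI⟩ : ∃ I : Finset (Fin n), I.card = m - i := by
    obtain ⟨I, -, h⟩ := Finset.exists_subset_card_eq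
      (s := (Finset.univ : Finset (Fin n))) (n := m - i) (by simp; omega)
    exact ⟨I, h⟩
  have h1 := slab hg hc T I i
  rw [hI, show i + (m - i) = m by omega] at h1
  have hsub : Metric.ball (0 : EuclideanSpace ℝ (Fin n)) T ⊆ {y | ∀ i ∈ I, |y i| ≤ T} := by
    intro y hy k _
    have h2 := (mem_ball_zero_iff.1 hy).le
    have h3 := PiLp.norm_apply_le y k
    rw [Real.norm_eq_abs] at h3
    exact h3.trans h2
  have h2 := (lintegral_mono_set hsub).trans h1
  rw [Ln, integral_norm_eq_lintegral_enorm (Ln_int hg hc m).1,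
    integral_norm_eq_lintegral_enorm (Ln_int hg hc i).1.restrict]
  have fin : ∫⁻ y, ‖iteratedFDeriv ℝ m g y‖ₑ ≠ ⊤ := (Ln_int hg hc m).2.ne
  have h3 := ENNReal.toReal_mono (by finiteness) h2
  refine h3.trans_eq ?_
  rw [ENNReal.toReal_mul, ENNReal.toReal_pow, ENNReal.toReal_ofReal (by linarith)]



lemma part1b {n : ℕ} (l : List ℝ) : ∃ A : ℝ, 0 ≤ A ∧ ∀ g : EuclideanSpace ℝ (Fin n) → ℝ,
    ContDiff ℝ (⊤ : ℕ∞) g → ∀ μ : EuclideanSpace ℝ (Fin n) → ℝ, IsWt μ → ∀ B : ℝ,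
    (∀ w, |μ w| ≤ B) → ∀ T : ℝ, 0 < T → |hop l (Jm g μ) T| ≤ A * B *
      ∑ i ∈ Finset.range (l.length + 1), T ^ i * ((T ^ n)⁻¹ *
        ∫ y in Metric.ball (0 : EuclideanSpace ℝ (Fin n)) T, ‖iteratedFDeriv ℝ i g y‖) := by
  obtain ⟨A, hA, h⟩ := part1 (n := n) l
  refine ⟨A, hA, ?_⟩
  intro g hg μ hμ B hB T hT
  refine (h g hg μ hμ B hB T).trans_eq ?_
  congr 1
  apply Finset.sum_congr rfl
  intro i _
  rw [abs_of_pos hT, Measure.setIntegral_comp_smul_of_pos volume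
    (fun y => ‖iteratedFDeriv ℝ i g y‖) _ hT, smul_unitBall_of_pos hT]
  simp

lemma est_large {n : ℕ} {a : ℝ} (ha : 0 < a) (l : List ℝ) (hal : a ≤ l.length) :
    ∃ C : ℝ, 0 ≤ C ∧ ∀ g : EuclideanSpace ℝ (Fin n) → ℝ, ContDiff ℝ (⊤ : ℕ∞) g →
      HasCompactSupport g → ∀ T : ℝ, 1 ≤ T →
      |hop l (Jm g (fun w => pw a (‖w‖ ^ 2))) T| ≤ C * T ^ ((l.length : ℝ) - n - a) *
        ∑ i ∈ Finset.range (l.length + 1), Ln i g := by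
  set l' := l.map (fun c => ((n : ℝ) - c) / 2) with hl'
  have hlen : l'.length = l.length := by simp [hl']
  obtain ⟨K, hK, hKb⟩ := theta_exists ha l' (by rwa [hlen])
  obtain ⟨A, hA, hAb⟩ := part1b (n := n) l
  obtain ⟨A', hA', hAb'⟩ := part1b (n := n) []
  refine ⟨A * K + 2 ^ l.length * (A' * K), by positivity, ?_⟩
  intro g hg hc T hT
  have hT0 : 0 < T := by linarith
  obtain ⟨θ, sθ, zθ, dθ, bθ⟩ := hKb T⁻¹ (by positivity) (inv_le_one_of_one_le₀ hT)
  have hδ : 0 < T⁻¹ := by positivity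
  have hP := isProf_of hδ sθ zθ
  have w1 := hP.wt (n := n)
  have w0 := pw_wt (n := n) ha
  set S := ∑ i ∈ Finset.range (l.length + 1), Ln i g with hS
  have hS0 : 0 ≤ S := Finset.sum_nonneg fun i _ => Ln_nonneg i g
  have cg := hg.continuous
  -- splitting
  have wd : IsWt (fun w : EuclideanSpace ℝ (Fin n) => pw a (‖w‖ ^ 2) - θ (‖w‖ ^ 2)) := by
    refine ⟨w0.1.sub w1.1, fun w hw => ?_⟩
    have h1 := w0.2 w hw
    have h2 := w1.2 w hw
    beta_reduce at h1 h2
    show pw a (‖w‖ ^ 2) - θ (‖w‖ ^ 2) = 0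
    rw [h1, h2, sub_zero]
  have split : Jm g (fun w => pw a (‖w‖ ^ 2)) = fun r =>
      Jm g (fun w => pw a (‖w‖ ^ 2) - θ (‖w‖ ^ 2)) r + Jm g (fun w => θ (‖w‖ ^ 2)) r := by
    ext r
    unfold Jm
    rw [← integral_add (wd.integrable_mul (f := fun w => g (r • w)) (by fun_prop))
      (w1.integrable_mul (f := fun w => g (r • w)) (by fun_prop))]
    congr 1; ext w; ring
  rw [split, hop_add l (Jm_contDiff hg wd) (Jm_contDiff hg w1)]
  refine (abs_add_le _ _).trans ?_
  have e1 : (T⁻¹) ^ a = T ^ (-a) := by rw [Real.inv_rpow hT0.le, Real.rpow_neg hT0.le]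
  have p1 : |hop l (Jm g (fun w => pw a (‖w‖ ^ 2) - θ (‖w‖ ^ 2))) T| ≤
      A * K * T ^ ((l.length : ℝ) - n - a) * S := by
    refine (hAb g hg _ wd _ (fun w => dθ (‖w‖ ^ 2)) T hT0).trans ?_
    have e2 : T ^ ((l.length : ℝ) - n - a) = T ^ (-a) * (T ^ l.length * (T ^ n)⁻¹) := by
      rw [← Real.rpow_natCast, ← Real.rpow_natCast, ← Real.rpow_neg hT0.le,
        ← Real.rpow_add hT0, ← Real.rpow_add hT0]
      congr 1; ring
    rw [e1, e2]
    calc A * (K * T ^ (-a)) * ∑ i ∈ Finset.range (l.length + 1), T ^ i * ((T ^ n)⁻¹ *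
        ∫ y in Metric.ball (0 : EuclideanSpace ℝ (Fin n)) T, ‖iteratedFDeriv ℝ i g y‖)
        ≤ A * (K * T ^ (-a)) * ∑ i ∈ Finset.range (l.length + 1),
          T ^ l.length * ((T ^ n)⁻¹ * Ln i g) := by
          gcongr with i hi
          · have := Finset.mem_range.1 hi; omega
          · exact ball_le hg hc i T
      _ = _ := by rw [hS, ← Finset.mul_sum, ← Finset.mul_sum]; ring
  have p2 : |hop l (Jm g (fun w => θ (‖w‖ ^ 2))) T| ≤
      2 ^ l.length * (A' * K) * T ^ ((l.length : ℝ) - n - a) * S := by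
    rw [hop_Jm hg hδ sθ zθ l, abs_mul, abs_pow]
    have w2 : IsWt (fun w : EuclideanSpace ℝ (Fin n) => hop l' θ (‖w‖ ^ 2)) :=
      (isProf_of hδ (hop_contDiff l' sθ) (hop_zero_of l' zθ)).wt
    have hB : ∀ w : EuclideanSpace ℝ (Fin n), |hop l' θ (‖w‖ ^ 2)| ≤
        K * (T⁻¹) ^ (a - l'.length) := by
      intro w
      rcases le_or_gt (‖w‖ ^ 2) 1 with h | h
      · exact bθ _ (sq_nonneg _) h
      · rw [hop_zero_of l' zθ _ (by linarith), abs_zero]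
        exact mul_nonneg hK (Real.rpow_nonneg hδ.le _)
    have h1 := hAb' g hg _ w2 _ hB T hT0
    simp only [hop, List.length_nil, zero_add, Finset.range_one, Finset.sum_singleton,
      pow_zero, one_mul] at h1
    have e2 : T ^ ((l.length : ℝ) - n - a) = (T⁻¹) ^ (a - l'.length) * (T ^ n)⁻¹ := by
      rw [hlen, Real.inv_rpow hT0.le, ← Real.rpow_natCast, ← Real.rpow_neg hT0.le,
        ← Real.rpow_neg hT0.le, ← Real.rpow_add hT0]
      congr 1; ring
    have h3 : Ln 0 g ≤ S := Finset.single_le_sum (f := fun i => Ln i g)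
      (fun i _ => Ln_nonneg i g) (Finset.mem_range.2 (by omega))
    have h4 := (ball_le hg hc 0 T).trans h3
    rw [show |(-2 : ℝ)| = 2 by norm_num, e2]
    have h5 : 0 ≤ (T⁻¹) ^ (a - l'.length) := Real.rpow_nonneg hδ.le _
    calc _ ≤ 2 ^ l.length * (A' * (K * (T⁻¹) ^ (a - l'.length)) * ((T ^ n)⁻¹ * S)) := by
            refine mul_le_mul_of_nonneg_left (h1.trans ?_) (by positivity)
            gcongr
      _ = _ := by ring
  linarith [p1, p2]

lemma est_small {n : ℕ} {a : ℝ} (ha : 0 < a) (l : List ℝ) (hln : l.length ≤ n) :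
    ∃ C : ℝ, 0 ≤ C ∧ ∀ g : EuclideanSpace ℝ (Fin n) → ℝ, ContDiff ℝ (⊤ : ℕ∞) g →
      HasCompactSupport g → ∀ T : ℝ, 0 < T →
      |hop l (Jm g (fun w => pw a (‖w‖ ^ 2))) T| ≤ C * (T ^ l.length * (T ^ n)⁻¹) *
        ∑ i ∈ Finset.range (l.length + 1), Ln i g := by
  obtain ⟨A, hA, hAb⟩ := part1b (n := n) l
  refine ⟨A * ∑ i ∈ Finset.range (l.length + 1), 2 ^ (l.length - i), by positivity, ?_⟩
  intro g hg hc T hT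
  have w0 := pw_wt (n := n) ha
  have hB : ∀ w : EuclideanSpace ℝ (Fin n), |pw a (‖w‖ ^ 2)| ≤ 1 := by
    intro w
    unfold pw
    rw [abs_of_nonneg (Real.rpow_nonneg (le_max_left _ _) _)]
    exact Real.rpow_le_one (le_max_left _ _) (max_le zero_le_one (by nlinarith [sq_nonneg ‖w‖])) ha.le
  refine (hAb g hg _ w0 1 hB T hT).trans ?_
  have h3 : Ln l.length g ≤ ∑ i ∈ Finset.range (l.length + 1), Ln i g :=
    Finset.single_le_sum (f := fun i => Ln i g)
      (fun i _ => Ln_nonneg i g) (Finset.mem_range.2 (by omega))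
  have h4 : ∑ i ∈ Finset.range (l.length + 1), T ^ i * ((T ^ n)⁻¹ *
        ∫ y in Metric.ball (0 : EuclideanSpace ℝ (Fin n)) T, ‖iteratedFDeriv ℝ i g y‖) ≤
      ∑ i ∈ Finset.range (l.length + 1), 2 ^ (l.length - i) *
        ((T ^ l.length * (T ^ n)⁻¹) * ∑ i ∈ Finset.range (l.length + 1), Ln i g) := by
    apply Finset.sum_le_sum
    intro i hi
    have hi' : i ≤ l.length := by have := Finset.mem_range.1 hi; omega
    have h5 := (ball_slab hg hc hT.le hi' hln).trans
      (mul_le_mul_of_nonneg_left h3 (by positivity : 0 ≤ (2 * T) ^ (l.length - i)))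
    calc _ ≤ T ^ i * ((T ^ n)⁻¹ * ((2 * T) ^ (l.length - i) *
              ∑ i ∈ Finset.range (l.length + 1), Ln i g)) := by gcongr
      _ = _ := by
        rw [mul_pow, ← pow_mul_pow_sub T hi']; ring
  rw [← Finset.sum_mul] at h4
  calc _ ≤ A * 1 * _ := mul_le_mul_of_nonneg_left h4 (by positivity)
    _ = _ := by ring



lemma pw_int_pos {n : ℕ} {a : ℝ} (ha : 0 < a) :
    0 < ∫ w : EuclideanSpace ℝ (Fin n), pw a (‖w‖ ^ 2) := by
  have hw := pw_wt (n := n) ha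
  refine Continuous.integral_pos_of_hasCompactSupport_nonneg_nonzero (x := 0) hw.1
    hw.hasCompactSupport (fun w => ?_) ?_
  · exact Real.rpow_nonneg (le_max_left _ _) _
  · simp [pw]

lemma decay_large {a T : ℝ} (ha : 0 < a) (hT : 1 ≤ T) :
    T ^ (-a) ≤ 2 ^ a * (1 + T) ^ (-a) := by
  have hT0 : 0 < T := by linarith
  have h1 : (2 * T) ^ (-a) ≤ (1 + T) ^ (-a) :=
    Real.rpow_le_rpow_of_nonpos (by linarith) (by linarith) (by linarith)
  rw [Real.mul_rpow (by norm_num) hT0.le] at h1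
  have h2 : (2 : ℝ) ^ a * 2 ^ (-a) = 1 := by
    rw [← Real.rpow_add (by norm_num)]; simp
  calc T ^ (-a) = 2 ^ a * (2 ^ (-a) * T ^ (-a)) := by rw [← mul_assoc, h2, one_mul]
    _ ≤ _ := by gcongr

lemma decay_small {a T : ℝ} (ha : 0 < a) (hT0 : 0 ≤ T) (hT : T ≤ 1) :
    1 ≤ 2 ^ a * (1 + T) ^ (-a) := by
  have h1 : (2 : ℝ) ^ (-a) ≤ (1 + T) ^ (-a) :=
    Real.rpow_le_rpow_of_nonpos (by linarith) (by linarith) (by linarith)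
  have h2 : (2 : ℝ) ^ a * 2 ^ (-a) = 1 := by
    rw [← Real.rpow_add (by norm_num)]; simp
  exact h2.symm.le.trans (mul_le_mul_of_nonneg_left h1 (by positivity))

lemma center_pos (n : ℕ) (hn : 2 ≤ n) :
    ∃ C : ℝ, 0 ≤ C ∧ ∀ u : ℝ × EuclideanSpace ℝ (Fin n) → ℝ, ContDiff ℝ (⊤ : ℕ∞) u →
      (∀ p : ℝ × EuclideanSpace ℝ (Fin n), 0 < p.1 →
        wdt n (wdt n u) p = ∑ i, wdi n i (wdi n i u) p) →
      HasCompactSupport (fun x => u (0, x)) → HasCompactSupport (fun x => wdt n u (0, x)) →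
      ∀ T : ℝ, 0 < T → |u (T, 0)| ≤ C * ((∑ i ∈ Finset.range (n + 1), Ln i (fun x => u (0, x))) +
        ∑ i ∈ Finset.range n, Ln i (fun x => wdt n u (0, x))) *
        (1 + T) ^ (-(((n : ℝ) - 1) / 2)) := by
  have hn' : (2 : ℝ) ≤ n := by exact_mod_cast hn
  set a : ℝ := ((n : ℝ) - 1) / 2 with hadef
  have ha : 0 < a := by rw [hadef]; linarith
  have han : 2 * a = n - 1 := by rw [hadef]; ring
  have hl0 := oddl_length 0 n
  have hl1 := oddl_length 1 (n - 1)
  have hc1 : ((n - 1 : ℕ) : ℝ) = n - 1 := by rw [Nat.cast_sub (by omega)]; simp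
  obtain ⟨A, hA, hAb⟩ := est_large (n := n) ha (oddl 0 n) (by rw [hl0]; linarith)
  obtain ⟨B, hB, hBb⟩ := est_large (n := n) ha (oddl 1 (n - 1)) (by rw [hl1, hc1]; linarith)
  obtain ⟨A', hA', hAb'⟩ := est_small (n := n) ha (oddl 0 n) (by rw [hl0])
  obtain ⟨B', hB', hBb'⟩ := est_small (n := n) ha (oddl 1 (n - 1)) (by rw [hl1]; omega)
  rw [hl0] at hAb hAb'
  rw [hl1, show n - 1 + 1 = n by omega] at hBb hBb'
  rw [hc1] at hBb
  set I := ∫ w : EuclideanSpace ℝ (Fin n), pw a (‖w‖ ^ 2) with hI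
  have hIpos : 0 < I := pw_int_pos ha
  set P := (oddl 1 (n - 1)).prod with hP
  have hPpos : 0 < P := oddl_pos _ _
  refine ⟨(A + B + A' + B') * 2 ^ a / (P * I), by positivity, ?_⟩
  intro u hu hpde c0 c1 T hT
  have s0 : ContDiff ℝ (⊤ : ℕ∞) (fun x : EuclideanSpace ℝ (Fin n) => u (0, x)) :=
    hu.comp (contDiff_const.prodMk contDiff_id)
  have s1 : ContDiff ℝ (⊤ : ℕ∞) (fun x : EuclideanSpace ℝ (Fin n) => wdt n u (0, x)) :=
    (wdt_contDiff hu).comp (contDiff_const.prodMk contDiff_id)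
  have hr := repr_formula hn hu hpde ha han hT.le
  rw [← hI, ← hP] at hr
  have a1 := hAb _ s0 c0 T
  have a2 := hBb _ s1 c1 T
  have a3 := hAb' _ s0 c0 T hT
  have a4 := hBb' _ s1 c1 T hT
  set S0 := ∑ i ∈ Finset.range (n + 1), Ln i (fun x => u (0, x)) with hS0
  set S1 := ∑ i ∈ Finset.range n, Ln i (fun x => wdt n u (0, x)) with hS1
  have p0 : 0 ≤ S0 := Finset.sum_nonneg fun i _ => Ln_nonneg i _
  have p1 : 0 ≤ S1 := Finset.sum_nonneg fun i _ => Ln_nonneg i _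
  set X := hop (oddl 0 n) (Jm (fun x => u (0, x)) (fun w => pw a (‖w‖ ^ 2))) T
  set Y := hop (oddl 1 (n - 1)) (Jm (fun x => wdt n u (0, x)) (fun w => pw a (‖w‖ ^ 2))) T
  have key : |X + T * Y| ≤ (A + B + A' + B') * (S0 + S1) * (2 ^ a * (1 + T) ^ (-a)) := by
    have h0 : |X + T * Y| ≤ |X| + T * |Y| := by
      refine (abs_add_le _ _).trans ?_
      rw [abs_mul, abs_of_pos hT]
    refine h0.trans ?_
    rcases le_total 1 T with h | h
    · have a1 := a1 h
      have a2 := mul_le_mul_of_nonneg_left (a2 h) hT.le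
      have e1 : T ^ ((n : ℝ) - n - a) = T ^ (-a) := by congr 1; ring
      have e2 : T * (B * T ^ ((n : ℝ) - 1 - n - a) * S1) = B * T ^ (-a) * S1 := by
        have : T ^ (-a) = T * T ^ ((n : ℝ) - 1 - n - a) := by
          conv_rhs => rw [← Real.rpow_one_add' hT.le (by linarith)]
          congr 1; ring
        rw [this]; ring
      rw [e1] at a1
      rw [e2] at a2
      have hd := decay_large ha h
      have hp : 0 ≤ T ^ (-a) := Real.rpow_nonneg hT.le _
      calc |X| + T * |Y| ≤ (A * S0 + B * S1) * T ^ (-a) := by linarith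
        _ ≤ ((A + B + A' + B') * (S0 + S1)) * (2 ^ a * (1 + T) ^ (-a)) := by
          refine mul_le_mul ?_ hd hp (by positivity)
          have : (A + B + A' + B') * (S0 + S1) = A * S0 + B * S1 + (B * S0 + A' * S0 + B' * S0 +
            A * S1 + A' * S1 + B' * S1) := by ring
          rw [this]
          have : 0 ≤ (B * S0 + A' * S0 + B' * S0 + A * S1 + A' * S1 + B' * S1) := by positivity
          linarith
    · have a4 := mul_le_mul_of_nonneg_left a4 hT.le
      have e1 : T ^ n * (T ^ n)⁻¹ = 1 := mul_inv_cancel₀ (by positivity)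
      have e2 : T * (B' * (T ^ (n - 1) * (T ^ n)⁻¹) * S1) = B' * S1 := by
        have : T * (T ^ (n - 1) * (T ^ n)⁻¹) = 1 := by
          rw [← mul_assoc, ← pow_succ', show n - 1 + 1 = n by omega, e1]
        calc _ = B' * (T * (T ^ (n - 1) * (T ^ n)⁻¹)) * S1 := by ring
          _ = _ := by rw [this, mul_one]
      rw [e1, mul_one] at a3
      rw [e2] at a4
      have hd := decay_small ha hT.le h
      calc |X| + T * |Y| ≤ (A' * S0 + B' * S1) * 1 := by linarith
        _ ≤ ((A + B + A' + B') * (S0 + S1)) * (2 ^ a * (1 + T) ^ (-a)) := by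
          refine mul_le_mul ?_ hd zero_le_one (by positivity)
          have : (A + B + A' + B') * (S0 + S1) = A' * S0 + B' * S1 + (B * S0 + A * S0 + B' * S0 +
            A * S1 + A' * S1 + B * S1) := by ring
          rw [this]
          have : 0 ≤ (B * S0 + A * S0 + B' * S0 + A * S1 + A' * S1 + B * S1) := by positivity
          linarith
  rw [← hr] at key
  have hPI : 0 < P * I := by positivity
  have e3 : |P * (u (T, 0) * I)| = P * I * |u (T, 0)| := by
    rw [show P * (u (T, 0) * I) = P * I * u (T, 0) by ring, abs_mul, abs_of_pos hPI]
  rw [e3] at key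
  have e4 : (A + B + A' + B') * 2 ^ a / (P * I) * (S0 + S1) * (1 + T) ^ (-a) =
      ((A + B + A' + B') * (S0 + S1) * (2 ^ a * (1 + T) ^ (-a))) / (P * I) := by ring
  rw [e4, le_div_iff₀ hPI]
  linarith

lemma center_bd (n : ℕ) (hn : 2 ≤ n) :
    ∃ C : ℝ, 0 ≤ C ∧ ∀ u : ℝ × EuclideanSpace ℝ (Fin n) → ℝ, ContDiff ℝ (⊤ : ℕ∞) u →
      (∀ p : ℝ × EuclideanSpace ℝ (Fin n), 0 < p.1 →
        wdt n (wdt n u) p = ∑ i, wdi n i (wdi n i u) p) →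
      HasCompactSupport (fun x => u (0, x)) → HasCompactSupport (fun x => wdt n u (0, x)) →
      ∀ T : ℝ, 0 ≤ T → |u (T, 0)| ≤ C * ((∑ i ∈ Finset.range (n + 1), Ln i (fun x => u (0, x))) +
        ∑ i ∈ Finset.range n, Ln i (fun x => wdt n u (0, x))) *
        (1 + T) ^ (-(((n : ℝ) - 1) / 2)) := by
  obtain ⟨C, hC, h⟩ := center_pos n hn
  refine ⟨C, hC, fun u hu hpde c0 c1 T hT => ?_⟩
  rcases hT.eq_or_lt with rfl | hT
  · set S := C * ((∑ i ∈ Finset.range (n + 1), Ln i (fun x => u (0, x))) +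
        ∑ i ∈ Finset.range n, Ln i (fun x => wdt n u (0, x))) with hS
    have t1 : Filter.Tendsto (fun T : ℝ => |u (T, 0)|) (nhdsWithin 0 (Set.Ioi 0))
        (nhds |u (0, 0)|) := by
      have hc : Continuous (fun T : ℝ => |u (T, 0)|) := by
        have := hu.continuous
        fun_prop
      exact (hc.tendsto 0).mono_left nhdsWithin_le_nhds
    have t2 : Filter.Tendsto (fun T : ℝ => S * (1 + T) ^ (-(((n : ℝ) - 1) / 2)))
        (nhdsWithin 0 (Set.Ioi 0)) (nhds (S * (1 + (0 : ℝ)) ^ (-(((n : ℝ) - 1) / 2)))) := by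
      have hc : ContinuousAt (fun T : ℝ => S * (1 + T) ^ (-(((n : ℝ) - 1) / 2))) 0 := by
        refine continuousAt_const.mul ?_
        refine ContinuousAt.rpow_const (by fun_prop) (Or.inl (by norm_num))
      exact hc.tendsto.mono_left nhdsWithin_le_nhds
    refine le_of_tendsto_of_tendsto t1 t2 ?_
    filter_upwards [self_mem_nhdsWithin] with T hT
    exact h u hu hpde c0 c1 T hT
  · exact h u hu hpde c0 c1 T hT

lemma wdt_shift {n : ℕ} (u : ℝ × EuclideanSpace ℝ (Fin n) → ℝ)
    (c : ℝ × EuclideanSpace ℝ (Fin n)) :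
    wdt n (fun p => u (p + c)) = fun p => wdt n u (p + c) := by
  ext p; unfold wdt; rw [fderiv_comp_add_right]

lemma wdi_shift {n : ℕ} (i : Fin n) (u : ℝ × EuclideanSpace ℝ (Fin n) → ℝ)
    (c : ℝ × EuclideanSpace ℝ (Fin n)) :
    wdi n i (fun p => u (p + c)) = fun p => wdi n i u (p + c) := by
  ext p; unfold wdi; rw [fderiv_comp_add_right]

lemma Ln_shift {n : ℕ} (i : ℕ) (g : EuclideanSpace ℝ (Fin n) → ℝ)
    (c : EuclideanSpace ℝ (Fin n)) : Ln i (fun x => g (x + c)) = Ln i g := by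
  unfold Ln
  simp only [iteratedFDeriv_comp_add_right]
  exact integral_add_right_eq_self (fun x => ‖iteratedFDeriv ℝ i g x‖) c

lemma Ln_eLpNorm {n : ℕ} {g : EuclideanSpace ℝ (Fin n) → ℝ} (hg : ContDiff ℝ (⊤ : ℕ∞) g)
    (hc : HasCompactSupport g) (i : ℕ) :
    eLpNorm (iteratedFDeriv ℝ i g) 1 volume = ENNReal.ofReal (Ln i g) := by
  rw [eLpNorm_one_eq_lintegral_enorm, Ln, ofReal_integral_norm_eq_lintegral_enorm (Ln_int hg hc i)]

/-- Klainerman's `L^∞–L¹` decay estimate for the homogeneous wave equation: for `n ≥ 2` there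
is `C > 0` (depending only on `n`) such that if `u₀, u₁ ∈ C_c^∞(ℝⁿ)` and `u` is a smooth
function with `∂ₜ²u = Δu` for `t > 0`, `u(0,·) = u₀`, `∂ₜu(0,·) = u₁`, then for all `t ≥ 0`,
`‖u(t,·)‖_{L^∞} ≤ C (Σ_{|α| ≤ n} ‖∂^α u₀‖_{L¹} + Σ_{|α| ≤ n−1} ‖∂^α u₁‖_{L¹}) (1+t)^{−(n−1)/2}`. -/
theorem stmt_6 (n : ℕ) (hn : 2 ≤ n) :
    ∃ C > (0:ℝ), ∀ u₀ u₁ : EuclideanSpace ℝ (Fin n) → ℝ,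
      ∀ u : ℝ × EuclideanSpace ℝ (Fin n) → ℝ,
      ContDiff ℝ (⊤ : ℕ∞) u₀ → HasCompactSupport u₀ →
      ContDiff ℝ (⊤ : ℕ∞) u₁ → HasCompactSupport u₁ →
      ContDiff ℝ (⊤ : ℕ∞) u →
      (∀ p : ℝ × EuclideanSpace ℝ (Fin n), 0 < p.1 →
        wdt n (wdt n u) p = ∑ i, wdi n i (wdi n i u) p) →
      (∀ x, u (0, x) = u₀ x) → (∀ x, wdt n u (0, x) = u₁ x) →
      ∀ t : ℝ, 0 ≤ t →
        eLpNorm (fun x : EuclideanSpace ℝ (Fin n) => u (t, x)) ⊤ volume ≤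
          ENNReal.ofReal C
            * ((∑ i ∈ Finset.range (n + 1), eLpNorm (iteratedFDeriv ℝ i u₀) 1 volume)
               + ∑ i ∈ Finset.range n, eLpNorm (iteratedFDeriv ℝ i u₁) 1 volume)
            * ENNReal.ofReal ((1 + t) ^ (-(((n : ℝ) - 1) / 2))) := by
  obtain ⟨C, hC, h⟩ := center_bd n hn
  refine ⟨C + 1, by linarith, ?_⟩
  intro u₀ u₁ u h0 k0 h1 k1 hu hpde i0 i1 t ht
  have q0 : 0 ≤ ∑ i ∈ Finset.range (n + 1), Ln i u₀ := Finset.sum_nonneg fun i _ => Ln_nonneg i _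
  have q1 : 0 ≤ ∑ i ∈ Finset.range n, Ln i u₁ := Finset.sum_nonneg fun i _ => Ln_nonneg i _
  have qd : 0 ≤ (1 + t) ^ (-(((n : ℝ) - 1) / 2)) := Real.rpow_nonneg (by linarith) _
  simp only [Ln_eLpNorm h0 k0, Ln_eLpNorm h1 k1]
  rw [← ENNReal.ofReal_sum_of_nonneg (fun i _ => Ln_nonneg i _),
    ← ENNReal.ofReal_sum_of_nonneg (fun i _ => Ln_nonneg i _), ← ENNReal.ofReal_add q0 q1,
    ← ENNReal.ofReal_mul (by linarith), ← ENNReal.ofReal_mul (by positivity),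
    eLpNorm_exponent_top]
  refine eLpNormEssSup_le_of_ae_bound (Filter.Eventually.of_forall fun x => ?_)
  set c : ℝ × EuclideanSpace ℝ (Fin n) := (0, x) with hc
  have e0 : (fun y : EuclideanSpace ℝ (Fin n) => u ((0, y) + c)) = fun y => u₀ (y + x) := by
    ext y; rw [← i0]; simp [hc]
  have e1 : (fun y : EuclideanSpace ℝ (Fin n) => wdt n u ((0, y) + c)) = fun y => u₁ (y + x) := by
    ext y; rw [← i1]; simp [hc]
  have hv := h (fun p => u (p + c)) (hu.comp (contDiff_id.add contDiff_const)) (by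
      intro p hp
      simp only [wdt_shift, wdi_shift]
      exact hpde (p + c) (by simpa [hc] using hp))
    (by rw [e0]; exact k0.comp_homeomorph (Homeomorph.addRight x))
    (by rw [wdt_shift]; rw [e1]; exact k1.comp_homeomorph (Homeomorph.addRight x)) t ht
  rw [wdt_shift] at hv
  beta_reduce at hv
  rw [e0, e1] at hv
  simp only [Ln_shift] at hv
  have e2 : ((t, (0 : EuclideanSpace ℝ (Fin n))) + c) = (t, x) := by simp [hc]
  rw [e2] at hv
  rw [Real.norm_eq_abs]
  refine hv.trans ?_
  gcongr
  linarith
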